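/- arXiv:1606.02410 — 11 statements merged into one kernel-verified Lean document; each statement's English description precedes it below -/
import Mathlib

section
/- Let R be a Poisson algebra over k and suppose the polynomial ring A = R[y₁,y₂] carries a Poisson bracket that restricts on R to the bracket of R and satisfies {y₂,y₁} = q₁₁y₁² + q₁₂y₁y₂ + w₁y₁ + w₂y₂ + w₀, {y₁,a} = α₁₁(a)y₁ + α₁₂(a)y₂ + ν₁(a), {y₂,a} = α₂₁(a)y₁ + α₂₂(a)y₂ + ν₂(a) for all a ∈ R, where q₁₁,q₁₂ ∈ k, w₀,w₁,w₂ ∈ R and α₁₁,α₁₂,α₂₁,α₂₂,ν₁,ν₂ : R → R are k-linear maps. Then each of the six maps α₁₁, α₁₂, α₂₁, α₂₂, ν₁, ν₂ is a derivation of R, i.e. satisfies f(ab) = a f(b) + b f(a) for all a,b ∈ R. -/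
open MvPolynomial

/-- `B` is a Poisson bracket on the commutative `k`-algebra `S`:
`k`-bilinear, antisymmetric, Jacobi, Leibniz. -/
def IsPoissonBr (k : Type*) [CommRing k] (S : Type*) [CommRing S] [Algebra k S]
    (B : S → S → S) : Prop :=
  (∀ a b c : S, B (a + b) c = B a c + B b c) ∧
  (∀ a b c : S, B a (b + c) = B a b + B a c) ∧
  (∀ (r : k) (a b : S), B (r • a) b = r • B a b) ∧
  (∀ (r : k) (a b : S), B a (r • b) = r • B a b) ∧
  (∀ a b : S, B a b = - B b a) ∧
  (∀ a b c : S, B a (B b c) + B b (B c a) + B c (B a b) = 0) ∧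
  (∀ a b c : S, B a (b * c) = B a b * c + b * B a c)

/-- A polynomial `a y₁ + b y₂ + c` of degree at most one determines its coefficients. -/
theorem linear_coeffs_eq {R : Type*} [CommRing R] {a b c a' b' c' : R}
    (h : (C a * X 0 + C b * X 1 + C c : MvPolynomial (Fin 2) R) =
      C a' * X 0 + C b' * X 1 + C c') : a = a' ∧ b = b' ∧ c = c' := by
  have h0 : c = c' := by simpa using congrArg (eval ![0, 0]) h
  subst h0
  exact ⟨by simpa using congrArg (eval ![1, 0]) h,
    by simpa using congrArg (eval ![0, 1]) h, rfl⟩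

/-- If a map `D` on `R[y₁, y₂]` satisfies the Leibniz rule and its values on constants are
`f a y₁ + g a y₂ + h a`, then `f`, `g` and `h` satisfy the Leibniz rule. -/
theorem leibniz_coeffs {R : Type*} [CommRing R]
    {D : MvPolynomial (Fin 2) R → MvPolynomial (Fin 2) R} {f g h : R → R}
    (hD : ∀ p q, D (p * q) = D p * q + p * D q)
    (hC : ∀ a, D (C a) = C (f a) * X 0 + C (g a) * X 1 + C (h a)) (a b : R) :
    f (a * b) = a * f b + b * f a ∧ g (a * b) = a * g b + b * g a ∧
      h (a * b) = a * h b + b * h a := by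
  apply linear_coeffs_eq
  rw [← hC, C_mul, hD, hC, hC]
  simp only [C_add, C_mul]
  ring

theorem stmt_2
    (k : Type*) [Field k] [CharZero k]
    (R : Type*) [CommRing R] [Algebra k R]
    (br : R → R → R) (hbr : IsPoissonBr k R br)
    (q11 q12 : k) (w0 w1 w2 : R)
    (α11 α12 α21 α22 ν1 ν2 : R →ₗ[k] R)
    (B : MvPolynomial (Fin 2) R → MvPolynomial (Fin 2) R → MvPolynomial (Fin 2) R)
    (hB : IsPoissonBr k (MvPolynomial (Fin 2) R) B)
    (hres : ∀ a b : R, B (C a) (C b) = C (br a b))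
    (hyy : B (X 1) (X 0) =
      q11 • X 0 ^ 2 + q12 • (X 0 * X 1) + C w1 * X 0 + C w2 * X 1 + C w0)
    (hy1 : ∀ a : R, B (X 0) (C a) = C (α11 a) * X 0 + C (α12 a) * X 1 + C (ν1 a))
    (hy2 : ∀ a : R, B (X 1) (C a) = C (α21 a) * X 0 + C (α22 a) * X 1 + C (ν2 a)) :
    (∀ a b : R, α11 (a * b) = a * α11 b + b * α11 a) ∧
    (∀ a b : R, α12 (a * b) = a * α12 b + b * α12 a) ∧
    (∀ a b : R, α21 (a * b) = a * α21 b + b * α21 a) ∧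
    (∀ a b : R, α22 (a * b) = a * α22 b + b * α22 a) ∧
    (∀ a b : R, ν1 (a * b) = a * ν1 b + b * ν1 a) ∧
    (∀ a b : R, ν2 (a * b) = a * ν2 b + b * ν2 a) := by
  have hL := hB.2.2.2.2.2.2
  have h1 := leibniz_coeffs (hL (X 0)) hy1
  have h2 := leibniz_coeffs (hL (X 1)) hy2
  exact ⟨fun a b => (h1 a b).1, fun a b => (h1 a b).2.1, fun a b => (h2 a b).1,
    fun a b => (h2 a b).2.1, fun a b => (h1 a b).2.2, fun a b => (h2 a b).2.2⟩
end

section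
/- Let R be a Poisson algebra over k and suppose the polynomial ring A = R[y₁,y₂] carries a Poisson bracket that restricts on R to the bracket of R and satisfies {y₂,y₁} = q₁₁y₁² + q₁₂y₁y₂ + w₁y₁ + w₂y₂ + w₀, {y₁,a} = α₁₁(a)y₁ + α₁₂(a)y₂ + ν₁(a), {y₂,a} = α₂₁(a)y₁ + α₂₂(a)y₂ + ν₂(a) for all a ∈ R, where q₁₁,q₁₂ ∈ k, w₀,w₁,w₂ ∈ R and α₁₁,α₁₂,α₂₁,α₂₂,ν₁,ν₂ : R → R are k-linear maps. Then for all a,b ∈ R: (i) α₁₁({a,b}) − {α₁₁(a),b} − {a,α₁₁(b)} = α₁₂(a)α₂₁(b) − α₂₁(a)α₁₂(b); (ii) α₂₂({a,b}) − {α₂₂(a),b} − {a,α₂₂(b)} = α₂₁(a)α₁₂(b) − α₁₂(a)α₂₁(b); (iii) α₁₂({a,b}) − {α₁₂(a),b} − {a,α₁₂(b)} = α₁₁(a)α₁₂(b) − α₁₂(a)α₁₁(b) + α₁₂(a)α₂₂(b) − α₂₂(a)α₁₂(b); (iv) α₂₁({a,b}) − {α₂₁(a),b} − {a,α₂₁(b)}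 = α₂₁(a)α₁₁(b) − α₁₁(a)α₂₁(b) + α₂₂(a)α₂₁(b) − α₂₁(a)α₂₂(b). -/
open MvPolynomial

/-- The coefficients of an affine linear form in two variables that vanishes are zero. -/
lemma coeff_eq_zero_of_linear_form_eq_zero {R : Type*} [CommRing R] {p q r : R}
    (h : (C p * X 0 + C q * X 1 + C r : MvPolynomial (Fin 2) R) = 0) : p = 0 ∧ q = 0 := by
  have hr : r = 0 := by simpa using congrArg (eval ![0, 0]) h
  subst hr
  exact ⟨by simpa using congrArg (eval ![1, 0]) h, by simpa using congrArg (eval ![0, 1]) h⟩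

/-- The Jacobi identity for `Y`, `C a`, `C b`, where bracketing with `Y` sends constants to
affine linear forms with coefficients `f`, `g`, `n`. -/
lemma linear_coeff_of_jacobi {k R : Type*} [CommRing k] [CommRing R] [Algebra k R]
    {br : R → R → R} {f g n α11 α12 α21 α22 ν1 ν2 : R → R}
    {B : MvPolynomial (Fin 2) R → MvPolynomial (Fin 2) R → MvPolynomial (Fin 2) R}
    (hB : IsPoissonBr k (MvPolynomial (Fin 2) R) B)
    (hres : ∀ a b : R, B (C a) (C b) = C (br a b))
    (hy1 : ∀ a : R, B (X 0) (C a) = C (α11 a) * X 0 + C (α12 a) * X 1 + C (ν1 a))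
    (hy2 : ∀ a : R, B (X 1) (C a) = C (α21 a) * X 0 + C (α22 a) * X 1 + C (ν2 a))
    {Y : MvPolynomial (Fin 2) R}
    (hY : ∀ a : R, B Y (C a) = C (f a) * X 0 + C (g a) * X 1 + C (n a)) (a b : R) :
    f (br a b) - br (f a) b - br a (f b) =
      f a * α11 b - α11 a * f b + g a * α21 b - α21 a * g b ∧
    g (br a b) - br (g a) b - br a (g b) =
      f a * α12 b - α12 a * f b + g a * α22 b - α22 a * g b := by
  obtain ⟨-, hadd, -, -, hanti, hjac, hleib⟩ := hB
  have key : ∀ c d : R, B (C c) (B Y (C d)) =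
      C (br c (f d)) * X 0 + C (br c (g d)) * X 1 + C (br c (n d))
      - C (f d) * (C (α11 c) * X 0 + C (α12 c) * X 1 + C (ν1 c))
      - C (g d) * (C (α21 c) * X 0 + C (α22 c) * X 1 + C (ν2 c)) := by
    intro c d
    rw [hY, hadd, hadd, hleib, hleib, hres, hres, hres, hanti (C c) (X 0), hanti (C c) (X 1),
      hy1, hy2]
    ring
  have hneg : ∀ u v, B u (-v) = -B u v := fun u v => by
    have h0 : B u 0 = 0 := by simpa using hadd u 0 0
    have h := hadd u v (-v)
    rw [add_neg_cancel, h0] at h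
    exact (neg_eq_of_add_eq_zero_right h.symm).symm
  have hbr : ∀ c d : R, br c d = -br d c := fun c d => by
    apply C_injective (Fin 2) R
    rw [C_neg, ← hres, ← hres, hanti]
  have h := hjac Y (C a) (C b)
  rw [hanti (C b) Y, hneg, key, key, hres, hY] at h
  have hlin := coeff_eq_zero_of_linear_form_eq_zero
    (p := f (br a b) - br a (f b) + br b (f a) + f b * α11 a + g b * α21 a
      - f a * α11 b - g a * α21 b)
    (q := g (br a b) - br a (g b) + br b (g a) + f b * α12 a + g b * α22 a
      - f a * α12 b - g a * α22 b)
    (r := n (br a b) - br a (n b) + br b (n a) + f b * ν1 a + g b * ν2 a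
      - f a * ν1 b - g a * ν2 b)
    (by simp only [C_add, C_sub, C_mul]; linear_combination h)
  exact ⟨by linear_combination hlin.1 - hbr (f a) b, by linear_combination hlin.2 - hbr (g a) b⟩

theorem stmt_3
    (k : Type*) [Field k] [CharZero k]
    (R : Type*) [CommRing R] [Algebra k R]
    (br : R → R → R) (hbr : IsPoissonBr k R br)
    (q11 q12 : k) (w0 w1 w2 : R)
    (α11 α12 α21 α22 ν1 ν2 : R →ₗ[k] R)
    (B : MvPolynomial (Fin 2) R → MvPolynomial (Fin 2) R → MvPolynomial (Fin 2) R)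
    (hB : IsPoissonBr k (MvPolynomial (Fin 2) R) B)
    (hres : ∀ a b : R, B (C a) (C b) = C (br a b))
    (hyy : B (X 1) (X 0) =
      q11 • X 0 ^ 2 + q12 • (X 0 * X 1) + C w1 * X 0 + C w2 * X 1 + C w0)
    (hy1 : ∀ a : R, B (X 0) (C a) = C (α11 a) * X 0 + C (α12 a) * X 1 + C (ν1 a))
    (hy2 : ∀ a : R, B (X 1) (C a) = C (α21 a) * X 0 + C (α22 a) * X 1 + C (ν2 a)) :
    (∀ a b : R, α11 (br a b) - br (α11 a) b - br a (α11 b) =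
      α12 a * α21 b - α21 a * α12 b) ∧
    (∀ a b : R, α22 (br a b) - br (α22 a) b - br a (α22 b) =
      α21 a * α12 b - α12 a * α21 b) ∧
    (∀ a b : R, α12 (br a b) - br (α12 a) b - br a (α12 b) =
      α11 a * α12 b - α12 a * α11 b + α12 a * α22 b - α22 a * α12 b) ∧
    (∀ a b : R, α21 (br a b) - br (α21 a) b - br a (α21 b) =
      α21 a * α11 b - α11 a * α21 b + α22 a * α21 b - α21 a * α22 b) := by
  have h1 := linear_coeff_of_jacobi hB hres hy1 hy2 hy1
  have h2 := linear_coeff_of_jacobi hB hres hy1 hy2 hy2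
  refine ⟨fun a b => ?_, fun a b => ?_, fun a b => ?_, fun a b => ?_⟩
  · linear_combination (h1 a b).1
  · linear_combination (h2 a b).2
  · linear_combination (h1 a b).2
  · linear_combination (h2 a b).1
end

section
/- Let R be a Poisson algebra over k and suppose the polynomial ring A = R[y₁,y₂] carries a Poisson bracket that restricts on R to the bracket of R and satisfies {y₂,y₁} = q₁₁y₁² + q₁₂y₁y₂ + w₁y₁ + w₂y₂ + w₀, {y₁,a} = α₁₁(a)y₁ + α₁₂(a)y₂ + ν₁(a), {y₂,a} = α₂₁(a)y₁ + α₂₂(a)y₂ + ν₂(a) for all a ∈ R, where q₁₁,q₁₂ ∈ k, w₀,w₁,w₂ ∈ R and α₁₁,α₁₂,α₂₁,α₂₂,ν₁,ν₂ : R → R are k-linear maps. Then for all a,b ∈ R: (i) ν₁({a,b}) − {ν₁(a),b} − {a,ν₁(b)} = α₁₁(a)ν₁(b) − ν₁(a)α₁₁(b) + α₁₂(a)ν₂(b) − ν₂(a)α₁₂(b); (ii) ν₂({a,b}) − {ν₂(a),b} − {a,ν₂(b)} = α₂₁(a)ν₁(b) − ν₁(a)α₂₁(b) + α₂₂(a)ν₂(b)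 − ν₂(a)α₂₂(b). -/
open MvPolynomial

/-- The constant coefficient of the bracket of a scalar with a polynomial of degree at most one. -/
theorem constantCoeff_bracket_C_linear {k R : Type*} [CommRing k] [CommRing R] [Algebra k R]
    {br : R → R → R} {α11 α12 α21 α22 ν1 ν2 : R → R}
    {B : MvPolynomial (Fin 2) R → MvPolynomial (Fin 2) R → MvPolynomial (Fin 2) R}
    (hB : IsPoissonBr k (MvPolynomial (Fin 2) R) B)
    (hres : ∀ a b : R, B (C a) (C b) = C (br a b))
    (hy1 : ∀ a : R, B (X 0) (C a) = C (α11 a) * X 0 + C (α12 a) * X 1 + C (ν1 a))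
    (hy2 : ∀ a : R, B (X 1) (C a) = C (α21 a) * X 0 + C (α22 a) * X 1 + C (ν2 a))
    (a x y z : R) :
    constantCoeff (B (C a) (C x * X 0 + C y * X 1 + C z)) =
      br a z - x * ν1 a - y * ν2 a := by
  obtain ⟨-, hadd, -, -, hanti, -, hleib⟩ := hB
  rw [hadd, hadd, hleib, hleib, hres, hres, hres, hanti (C a) (X 0), hanti (C a) (X 1), hy1, hy2]
  simp only [map_add, map_mul, map_neg, constantCoeff_C, constantCoeff_X]
  ring

/-- If bracketing with `Y` sends scalars to polynomials of degree at most one, the Jacobi identity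
determines how far the constant part `ν` of that map is from being a derivation of the bracket. -/
theorem constantPart_bracket_sub {k R : Type*} [CommRing k] [CommRing R] [Algebra k R]
    {br : R → R → R} {α11 α12 α21 α22 ν1 ν2 α β ν : R → R}
    {B : MvPolynomial (Fin 2) R → MvPolynomial (Fin 2) R → MvPolynomial (Fin 2) R}
    (hbr : ∀ a b : R, br a b = -br b a)
    (hB : IsPoissonBr k (MvPolynomial (Fin 2) R) B)
    (hres : ∀ a b : R, B (C a) (C b) = C (br a b))
    (hy1 : ∀ a : R, B (X 0) (C a) = C (α11 a) * X 0 + C (α12 a) * X 1 + C (ν1 a))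
    (hy2 : ∀ a : R, B (X 1) (C a) = C (α21 a) * X 0 + C (α22 a) * X 1 + C (ν2 a))
    {Y : MvPolynomial (Fin 2) R}
    (hY : ∀ a : R, B Y (C a) = C (α a) * X 0 + C (β a) * X 1 + C (ν a)) (a b : R) :
    ν (br a b) - br (ν a) b - br a (ν b) =
      α a * ν1 b - ν1 a * α b + β a * ν2 b - ν2 a * β b := by
  have key := constantCoeff_bracket_C_linear hB hres hy1 hy2
  obtain ⟨-, -, -, hsmul, hanti, hjac, -⟩ := hB
  have hneg : ∀ p q, B p (-q) = -B p q := fun p q => by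
    simpa using hsmul (-1) p q
  have h := congrArg constantCoeff (hjac Y (C a) (C b))
  rw [hanti (C b) Y, hneg, hres, hY, hY, hY, map_add, map_add, map_neg, key, key] at h
  simp only [map_add, map_mul, map_zero, constantCoeff_C, constantCoeff_X] at h
  rw [hbr (ν a) b]
  linear_combination h

theorem stmt_4
    (k : Type*) [Field k] [CharZero k]
    (R : Type*) [CommRing R] [Algebra k R]
    (br : R → R → R) (hbr : IsPoissonBr k R br)
    (q11 q12 : k) (w0 w1 w2 : R)
    (α11 α12 α21 α22 ν1 ν2 : R →ₗ[k] R)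
    (B : MvPolynomial (Fin 2) R → MvPolynomial (Fin 2) R → MvPolynomial (Fin 2) R)
    (hB : IsPoissonBr k (MvPolynomial (Fin 2) R) B)
    (hres : ∀ a b : R, B (C a) (C b) = C (br a b))
    (hyy : B (X 1) (X 0) =
      q11 • X 0 ^ 2 + q12 • (X 0 * X 1) + C w1 * X 0 + C w2 * X 1 + C w0)
    (hy1 : ∀ a : R, B (X 0) (C a) = C (α11 a) * X 0 + C (α12 a) * X 1 + C (ν1 a))
    (hy2 : ∀ a : R, B (X 1) (C a) = C (α21 a) * X 0 + C (α22 a) * X 1 + C (ν2 a)) :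
    (∀ a b : R, ν1 (br a b) - br (ν1 a) b - br a (ν1 b) =
      α11 a * ν1 b - ν1 a * α11 b + α12 a * ν2 b - ν2 a * α12 b) ∧
    (∀ a b : R, ν2 (br a b) - br (ν2 a) b - br a (ν2 b) =
      α21 a * ν1 b - ν1 a * α21 b + α22 a * ν2 b - ν2 a * α22 b) := by
  exact ⟨constantPart_bracket_sub hbr.2.2.2.2.1 hB hres hy1 hy2 hy1,
    constantPart_bracket_sub hbr.2.2.2.2.1 hB hres hy1 hy2 hy2⟩
end

section
/- Let R be a Poisson algebra over k and suppose the polynomial ring A = R[y₁,y₂] carries a Poisson bracket that restricts on R to the bracket of R and satisfies {y₂,y₁} = q₁₁y₁² + q₁₂y₁y₂ + w₁y₁ + w₂y₂ + w₀, {y₁,a} = α₁₁(a)y₁ + α₁₂(a)y₂ + ν₁(a), {y₂,a} = α₂₁(a)y₁ + α₂₂(a)y₂ + ν₂(a) for all a ∈ R, where q₁₁,q₁₂ ∈ k, w₀,w₁,w₂ ∈ R and α₁₁,α₁₂,α₂₁,α₂₂,ν₁,ν₂ : R → R are k-linear maps. Then, as equalities of maps R → R (with [f,g] = f∘g − g∘f,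 elements of R acting by multiplication, and {w,−} denoting a ↦ {w,a}): (8) [α₂₁,α₁₁] = q₁₁α₁₁ + q₁₂α₂₁ − q₁₁α₂₂; (9) [α₂₂,α₁₁] + [α₂₁,α₁₂] = 2q₁₁α₁₂; (10) [α₂₂,α₁₂] = q₁₂α₁₂; (11) [ν₂,α₁₁] + [α₂₁,ν₁] = 2q₁₁ν₁ + q₁₂ν₂ + w₂α₂₁ − w₁α₂₂ + {w₁,−}; (12) [ν₂,α₁₂] + [α₂₂,ν₁] = q₁₂ν₁ + w₁α₁₂ − w₂α₁₁ + {w₂,−}; (13) [ν₂,ν₁] = w₁ν₁ + w₂ν₂ − w₀α₁₁ − w₀α₂₂ + {w₀,−}. -/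
open MvPolynomial

/-- A bivariate polynomial of degree at most two vanishes only if all its coefficients do. -/
theorem coeffs_eq_zero_of_quadratic_eq_zero {R : Type*} [CommRing R] {a b c d e f : R}
    (h : C a * X 0 ^ 2 + C b * (X 0 * X 1) + C c * X 1 ^ 2 + C d * X 0 + C e * X 1 + C f =
      (0 : MvPolynomial (Fin 2) R)) :
    a = 0 ∧ b = 0 ∧ c = 0 ∧ d = 0 ∧ e = 0 ∧ f = 0 := by
  have hm : monomial (Finsupp.single 0 2) a +
      monomial (Finsupp.single 0 1 + Finsupp.single 1 1) b + monomial (Finsupp.single 1 2) c +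
      monomial (Finsupp.single 0 1) d + monomial (Finsupp.single 1 1) e + monomial 0 f =
      (0 : MvPolynomial (Fin 2) R) := by
    rw [← h]
    simp only [X, C_apply, monomial_pow, monomial_mul]
    simp
  have key (m : Fin 2 →₀ ℕ) := congrArg (coeff m) hm
  simp only [coeff_add, coeff_monomial, coeff_zero, Finsupp.ext_iff, Fin.forall_fin_two,
    Finsupp.add_apply, Finsupp.single_apply] at key
  refine ⟨?_, ?_, ?_, ?_, ?_, ?_⟩
  · simpa using key (Finsupp.single 0 2)
  · obtain ⟨m, h0, h1⟩ : ∃ m : Fin 2 →₀ ℕ, m 0 = 1 ∧ m 1 = 1 :=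
      ⟨Finsupp.single 0 1 + Finsupp.single 1 1, by simp⟩
    simpa [h0, h1] using key m
  · simpa using key (Finsupp.single 1 2)
  · simpa using key (Finsupp.single 0 1)
  · simpa using key (Finsupp.single 1 1)
  · simpa using key 0

theorem stmt_5
    (k : Type*) [Field k] [CharZero k]
    (R : Type*) [CommRing R] [Algebra k R]
    (br : R → R → R) (hbr : IsPoissonBr k R br)
    (q11 q12 : k) (w0 w1 w2 : R)
    (α11 α12 α21 α22 ν1 ν2 : R →ₗ[k] R)
    (B : MvPolynomial (Fin 2) R → MvPolynomial (Fin 2) R → MvPolynomial (Fin 2) R)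
    (hB : IsPoissonBr k (MvPolynomial (Fin 2) R) B)
    (hres : ∀ a b : R, B (C a) (C b) = C (br a b))
    (hyy : B (X 1) (X 0) =
      q11 • X 0 ^ 2 + q12 • (X 0 * X 1) + C w1 * X 0 + C w2 * X 1 + C w0)
    (hy1 : ∀ a : R, B (X 0) (C a) = C (α11 a) * X 0 + C (α12 a) * X 1 + C (ν1 a))
    (hy2 : ∀ a : R, B (X 1) (C a) = C (α21 a) * X 0 + C (α22 a) * X 1 + C (ν2 a)) :
    (∀ a : R, α21 (α11 a) - α11 (α21 a) = q11 • α11 a + q12 • α21 a - q11 • α22 a) ∧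
    (∀ a : R, α22 (α11 a) - α11 (α22 a) + (α21 (α12 a) - α12 (α21 a)) = (2 * q11) • α12 a) ∧
    (∀ a : R, α22 (α12 a) - α12 (α22 a) = q12 • α12 a) ∧
    (∀ a : R, ν2 (α11 a) - α11 (ν2 a) + (α21 (ν1 a) - ν1 (α21 a)) =
      (2 * q11) • ν1 a + q12 • ν2 a + w2 * α21 a - w1 * α22 a + br w1 a) ∧
    (∀ a : R, ν2 (α12 a) - α12 (ν2 a) + (α22 (ν1 a) - ν1 (α22 a)) =
      q12 • ν1 a + w1 * α12 a - w2 * α11 a + br w2 a) ∧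
    (∀ a : R, ν2 (ν1 a) - ν1 (ν2 a) =
      w1 * ν1 a + w2 * ν2 a - w0 * α11 a - w0 * α22 a + br w0 a) := by
  obtain ⟨-, add_right, -, smul_right, anti, jac, leib⟩ := hB
  have smul_eq (q : k) (p : MvPolynomial (Fin 2) R) : q • p = C (algebraMap k R q) * p := by
    rw [← algebraMap_smul R q p, smul_eq_C_mul]
  have hyy' := anti (X 0) (X 1)
  have hC (a b : R) : B (C a) (C b) = - C (br b a) := by rw [anti, hres]
  have hCy1 (a : R) : B (C a) (X 0) = - (C (α11 a) * X 0 + C (α12 a) * X 1 + C (ν1 a)) := by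
    rw [anti, hy1]
  have hCy2 (a : R) : B (C a) (X 1) = - (C (α21 a) * X 0 + C (α22 a) * X 1 + C (ν2 a)) := by
    rw [anti, hy2]
  have self_eq (p : MvPolynomial (Fin 2) R) : B p p = 0 := by
    have h2 : (2 : k) • B p p = 0 := by
      rw [two_smul]
      nth_rewrite 1 [anti p p]
      exact neg_add_cancel _
    exact (smul_eq_zero_iff_right (two_ne_zero (α := k))).1 h2
  have neg_right (p r : MvPolynomial (Fin 2) R) : B p (-r) = - B p r := by
    have := smul_right (-1) p r
    simpa using this
  have key (a : R) := coeffs_eq_zero_of_quadratic_eq_zero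
    (a := α21 (α11 a) - α11 (α21 a) - (q11 • α11 a + q12 • α21 a - q11 • α22 a))
    (b := α22 (α11 a) - α11 (α22 a) + (α21 (α12 a) - α12 (α21 a)) - (2 * q11) • α12 a)
    (c := α22 (α12 a) - α12 (α22 a) - q12 • α12 a)
    (d := ν2 (α11 a) - α11 (ν2 a) + (α21 (ν1 a) - ν1 (α21 a)) -
      ((2 * q11) • ν1 a + q12 • ν2 a + w2 * α21 a - w1 * α22 a + br w1 a))
    (e := ν2 (α12 a) - α12 (ν2 a) + (α22 (ν1 a) - ν1 (α22 a)) -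
      (q12 • ν1 a + w1 * α12 a - w2 * α11 a + br w2 a))
    (f := ν2 (ν1 a) - ν1 (ν2 a) -
      (w1 * ν1 a + w2 * ν2 a - w0 * α11 a - w0 * α22 a + br w0 a)) (by
    have h := jac (X 1) (X 0) (C a)
    rw [hyy, hCy2, hy1] at h
    simp only [add_right, neg_right, leib, smul_right, pow_two, self_eq, hyy', hyy, hy1, hy2,
      hCy1, hCy2, hC] at h
    simp only [smul_eq, Algebra.smul_def, C_add, C_sub, map_mul, map_ofNat] at h ⊢
    linear_combination h)
  simp only [sub_eq_zero] at key
  exact ⟨fun a => (key a).1, fun a => (key a).2.1, fun a => (key a).2.2.1,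
    fun a => (key a).2.2.2.1, fun a => (key a).2.2.2.2.1, fun a => (key a).2.2.2.2.2⟩
end

section
/- Let R be a Poisson algebra over k, let q₁₁, q₁₂ ∈ k, w₀, w₁, w₂ ∈ R, and let α₁₁, α₁₂, α₂₁, α₂₂, ν₁, ν₂ : R → R be k-linear maps. Then the polynomial ring R[y₁,y₂] admits a Poisson bracket that restricts on R to the bracket of R and satisfies {y₂,y₁} = q₁₁y₁² + q₁₂y₁y₂ + w₁y₁ + w₂y₂ + w₀, {y₁,a} = α₁₁(a)y₁ + α₁₂(a)y₂ + ν₁(a), {y₂,a} = α₂₁(a)y₁ + α₂₂(a)y₂ + ν₂(a) for all a ∈ R, if and only if the following thirteen conditions hold for all a,b ∈ R: (1) each of α₁₁,α₁₂,α₂₁,α₂₂,ν₁,ν₂ is a derivation of R; (2) α₁₁({a,b}) − {α₁₁(a),b} − {a,α₁₁(b)} = α₁₂(a)α₂₁(b) − α₂₁(a)α₁₂(b); (3) α₂₂({a,b}) − {α₂₂(a),b} − {a,α₂₂(b)} = α₂₁(a)α₁₂(b) − α₁₂(a)α₂₁(b); (4) α₁₂({a,b}) − {α₁₂(a),b} −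 {a,α₁₂(b)} = α₁₁(a)α₁₂(b) − α₁₂(a)α₁₁(b) + α₁₂(a)α₂₂(b) − α₂₂(a)α₁₂(b); (5) α₂₁({a,b}) − {α₂₁(a),b} − {a,α₂₁(b)} = α₂₁(a)α₁₁(b) − α₁₁(a)α₂₁(b) + α₂₂(a)α₂₁(b) − α₂₁(a)α₂₂(b); (6) ν₁({a,b}) − {ν₁(a),b} − {a,ν₁(b)} = α₁₁(a)ν₁(b) − ν₁(a)α₁₁(b) + α₁₂(a)ν₂(b) − ν₂(a)α₁₂(b); (7) ν₂({a,b}) − {ν₂(a),b} − {a,ν₂(b)} = α₂₁(a)ν₁(b) − ν₁(a)α₂₁(b) + α₂₂(a)ν₂(b) − ν₂(a)α₂₂(b); (8) [α₂₁,α₁₁] = q₁₁α₁₁ + q₁₂α₂₁ − q₁₁α₂₂; (9) [α₂₂,α₁₁] + [α₂₁,α₁₂] = 2q₁₁α₁₂; (10) [α₂₂,α₁₂] = q₁₂α₁₂; (11) [ν₂,α₁₁] + [α₂₁,ν₁] = 2q₁₁ν₁ + q₁₂ν₂ + w₂α₂₁ − w₁α₂₂ + {w₁,−}; (12) [ν₂,α₁₂]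 + [α₂₂,ν₁] = q₁₂ν₁ + w₁α₁₂ − w₂α₁₁ + {w₂,−}; (13) [ν₂,ν₁] = w₁ν₁ + w₂ν₂ − w₀α₁₁ − w₀α₂₂ + {w₀,−}. (In (8)–(13), [f,g] = f∘g − g∘f as maps R → R, elements of R act by multiplication, and {w,−} denotes the map a ↦ {w,a}.) -/
open MvPolynomial

namespace DoublePoissonExtension

theorem derivation_ext_C_X {k R σ M : Type*} [CommRing k] [CommRing R] [Algebra k R]
    [AddCommGroup M] [Module k M] [Module (MvPolynomial σ R) M]
    {D₁ D₂ : Derivation k (MvPolynomial σ R) M}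
    (hC : ∀ a, D₁ (C a) = D₂ (C a)) (hX : ∀ i, D₁ (X i) = D₂ (X i)) : D₁ = D₂ := by
  ext f
  induction f using MvPolynomial.induction_on with
  | C a => exact hC a
  | add p q hp hq => rw [map_add, map_add, hp, hq]
  | mul_X p i hp => rw [Derivation.leibniz, Derivation.leibniz, hp, hX]

theorem C_smul {k R σ : Type*} [CommRing k] [CommRing R] [Algebra k R] (r : k) (a : R) :
    (C (r • a) : MvPolynomial σ R) = r • C a := by
  rw [C_eq_smul_one, smul_assoc, ← C_eq_smul_one]

section Extension

variable {k R σ M : Type*} [CommRing k] [CommRing R] [Algebra k R]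
  [AddCommGroup M] [Module k M] [Module R M] [Module (MvPolynomial σ R) M]
  [IsScalarTower R (MvPolynomial σ R) M]
  [IsScalarTower k (MvPolynomial σ R) M]

/-- A derivation of `R` extends to the polynomial ring, with value zero on the variables. -/
theorem exists_derivation_extending (d : Derivation k R M) :
    ∃ D : Derivation k (MvPolynomial σ R) M, (∀ a, D (C a) = d a) ∧ ∀ i, D (X i) = 0 := by
  let L : MvPolynomial σ R →ₗ[k] M :=
    { toFun f := Finsupp.sum (AddMonoidAlgebra.coeff f) fun m a => monomial m (1 : R) • d a
      map_add' f g := Finsupp.sum_add_index' (by simp) (by simp)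
      map_smul' r f := by
        simp only [RingHom.id_apply, Finsupp.smul_sum]
        refine (Finsupp.sum_smul_index' (g := AddMonoidAlgebra.coeff f) (by simp)).trans ?_
        simp only [Derivation.map_smul, smul_comm _ r] }
  have hL (m : σ →₀ ℕ) (a : R) : L (monomial m a) = monomial m (1 : R) • d a :=
    sum_monomial_eq (b := fun m a => monomial m (1 : R) • d a) (by rw [map_zero, smul_zero])
  have leibniz (p q : MvPolynomial σ R) : L (p * q) = p • L q + q • L p := by
    induction p using MvPolynomial.induction_on' with
    | add p₁ p₂ h₁ h₂ => simp only [add_mul, map_add, h₁, h₂, add_smul, smul_add]; abel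
    | monomial m a =>
      induction q using MvPolynomial.induction_on' with
      | add p₁ p₂ h₁ h₂ => simp only [mul_add, map_add, h₁, h₂, add_smul, smul_add]; abel
      | monomial n b =>
        have key (m n : σ →₀ ℕ) (a b : R) :
            monomial m a • monomial n (1 : R) • d b = monomial (m + n) (1 : R) • a • d b := by
          rw [← IsScalarTower.algebraMap_smul (MvPolynomial σ R) a, smul_smul, smul_smul,
            algebraMap_eq, monomial_mul, mul_comm _ (C a), C_mul_monomial]
        rw [monomial_mul, hL, hL, hL, d.leibniz, smul_add, key, key, add_comm n m]
  refine ⟨Derivation.mk' L leibniz, fun a => ?_, fun i => ?_⟩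
  · exact (hL 0 a).trans (one_smul _ _)
  · exact (hL (Finsupp.single i 1) 1).trans (by rw [d.map_one_eq_zero, smul_zero])

/-- A derivation on a polynomial ring may be prescribed on the coefficients and the variables. -/
theorem exists_derivation [IsScalarTower k R M] (d : Derivation k R M) (v : σ → M) :
    ∃ D : Derivation k (MvPolynomial σ R) M, (∀ a, D (C a) = d a) ∧ ∀ i, D (X i) = v i := by
  obtain ⟨D, hC, hX⟩ := exists_derivation_extending (σ := σ) d
  refine ⟨D + Derivation.mk' ((mkDerivation R v).toLinearMap.restrictScalars k) (by simp),
    fun a => ?_, fun i => ?_⟩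
  · exact (congrArg₂ (· + ·) (hC a) (derivation_C _ a)).trans (add_zero _)
  · exact (congrArg₂ (· + ·) (hX i) (mkDerivation_X R v i)).trans (zero_add _)

end Extension

section Biderivation

variable {k R σ : Type*} [CommRing k] [CommRing R] [Algebra k R]

/-- An antisymmetric biderivation of a polynomial ring may be prescribed on the coefficients and
the variables. -/
theorem exists_biderivation {br : R → R → R} (hbr : IsPoissonBr k R br)
    (ℓ : σ → Derivation k R (MvPolynomial σ R)) (P : σ → σ → MvPolynomial σ R)
    (hP : ∀ i j, P i j = -P j i) :
    ∃ D : Derivation k (MvPolynomial σ R) (Derivation k (MvPolynomial σ R) (MvPolynomial σ R)),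
      (∀ f g, D f g = -D g f) ∧ (∀ a b, D (C a) (C b) = C (br a b)) ∧
      (∀ i a, D (X i) (C a) = ℓ i a) ∧ ∀ i j, D (X i) (X j) = P i j := by
  obtain ⟨add_left, add_right, smul_left, smul_right, anti, -, leibniz⟩ := hbr
  have leibniz_left (a b c : R) : br (a * b) c = a * br b c + b * br a c := by
    rw [anti, leibniz, anti c a, anti c b]; ring
  let d (a : R) : Derivation k R (MvPolynomial σ R) := Derivation.mk'
    { toFun b := C (br a b)
      map_add' b c := by rw [add_right, C_add]
      map_smul' r b := by rw [smul_right, C_smul, RingHom.id_apply] }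
    (fun b c => by
      simp only [LinearMap.coe_mk, AddHom.coe_mk, leibniz, map_add, C_mul, smul_eq_C_mul]
      ring)
  choose E hEC hEX using fun a : R =>
    exists_derivation (σ := σ) (d a) (fun i => -ℓ i a)
  choose F hFC hFX using fun i => exists_derivation (σ := σ) (ℓ i) (P i)
  have hd (a b : R) : d a b = C (br a b) := rfl
  let e : Derivation k R (Derivation k (MvPolynomial σ R) (MvPolynomial σ R)) := Derivation.mk'
    { toFun := E
      map_add' a b := derivation_ext_C_X
        (by simp [hEC, hd, add_left]) (by simp [hEX, add_comm])
      map_smul' r a := derivation_ext_C_X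
        (by simp [hEC, hd, smul_left, C_smul]) (by simp [hEX]) }
    (fun a b => derivation_ext_C_X
      (by simp [hEC, hd, leibniz_left, C_mul, smul_eq_C_mul]) (by simp [hEX, add_comm]))
  obtain ⟨D, hC, hX⟩ := exists_derivation (σ := σ) e F
  have hCC (a b : R) : D (C a) (C b) = C (br a b) := by rw [hC]; exact hEC a b
  have hXC (i : σ) (a : R) : D (X i) (C a) = ℓ i a := by rw [hX, hFC]
  have hXX (i j : σ) : D (X i) (X j) = P i j := by rw [hX, hFX]
  have hCX (i : σ) (a : R) : D (C a) (X i) = -ℓ i a := by rw [hC]; exact hEX a i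
  refine ⟨D, fun f g => ?_, hCC, hXC, hXX⟩
  have step (h : MvPolynomial σ R) (hc : ∀ a, D h (C a) = -D (C a) h)
      (hx : ∀ i, D h (X i) = -D (X i) h) (f : MvPolynomial σ R) : D h f = -D f h := by
    induction f using MvPolynomial.induction_on with
    | C a => exact hc a
    | add p q hp hq => simp [hp, hq, add_comm]
    | mul_X p i hp => simp [Derivation.leibniz, hp, hx, add_comm]
  refine step f (fun a => ?_) (fun i => ?_) g
  · rw [step (C a) (fun b => ?_) (fun i => ?_), neg_neg]
    · rw [hCC, hCC, anti, C_neg]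
    · rw [hCX, hXC]
  · rw [step (X i) (fun b => ?_) (fun j => ?_), neg_neg]
    · rw [hCX, hXC, neg_neg]
    · rw [hXX, hXX, hP]

theorem jacobi_of_generators
    (D : Derivation k (MvPolynomial σ R) (Derivation k (MvPolynomial σ R) (MvPolynomial σ R)))
    (anti : ∀ f g, D f g = -D g f) (G : Set (MvPolynomial σ R))
    (hC : ∀ a, C a ∈ G) (hX : ∀ i, X i ∈ G)
    (hG : ∀ f ∈ G, ∀ g ∈ G, ∀ h ∈ G, D f (D g h) + D g (D h f) + D h (D f g) = 0)
    (f g h : MvPolynomial σ R) : D f (D g h) + D g (D h f) + D h (D f g) = 0 := by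
  have step (f g : MvPolynomial σ R)
      (H : ∀ h ∈ G, D f (D g h) + D g (D h f) + D h (D f g) = 0) (h : MvPolynomial σ R) :
      D f (D g h) + D g (D h f) + D h (D f g) = 0 := by
    have key : ⁅D f, D g⁆ = D (D f g) := by
      have aux (h) (hh : h ∈ G) : ⁅D f, D g⁆ h = D (D f g) h := by
        have := H h hh
        rw [anti h f, anti h, map_neg] at this
        rw [Derivation.commutator_apply]
        linear_combination this
      exact derivation_ext_C_X (fun a => aux _ (hC a)) (fun i => aux _ (hX i))
    have := DFunLike.congr_fun key h
    rw [Derivation.commutator_apply] at this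
    rw [anti h f, anti h, map_neg]
    linear_combination this
  refine step f g (fun h hh => ?_) h
  rw [add_right_comm, add_assoc, add_comm, add_right_comm]
  have := step h f (fun g hg => ?_) g
  · linear_combination this
  have := step g h (fun f hf => hG g hg h hh f hf) f
  linear_combination this

end Biderivation

section TwoVariables

variable {k R : Type*} [CommRing k] [CommRing R] [Algebra k R]

theorem quadratic_eq_zero_iff (a b c d e f : R) :
    (C a * X 0 ^ 2 + C b * (X 0 * X 1) + C c * X 1 ^ 2 + C d * X 0 + C e * X 1 + C f :
      MvPolynomial (Fin 2) R) = 0 ↔ a = 0 ∧ b = 0 ∧ c = 0 ∧ d = 0 ∧ e = 0 ∧ f = 0 := by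
  refine ⟨fun h => ?_, ?_⟩
  · have key (i j : ℕ) := congrArg (coeff (Finsupp.single 0 i + Finsupp.single 1 j)) h
    have aux (r : R) (i j m n : ℕ) :
        coeff (Finsupp.single (0 : Fin 2) i + Finsupp.single 1 j)
          (C r * (X 0 ^ m * X 1 ^ n) : MvPolynomial (Fin 2) R) =
          if m = i ∧ n = j then r else 0 := by
      rw [coeff_C_mul, X_pow_eq_monomial, X_pow_eq_monomial, monomial_mul, coeff_monomial]
      simp [Finsupp.ext_iff, Fin.forall_fin_two]
    have rw_eq : (C a * X 0 ^ 2 + C b * (X 0 * X 1) + C c * X 1 ^ 2 + C d * X 0 + C e * X 1 + C f :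
        MvPolynomial (Fin 2) R) = C a * (X 0 ^ 2 * X 1 ^ 0) + C b * (X 0 ^ 1 * X 1 ^ 1) +
        C c * (X 0 ^ 0 * X 1 ^ 2) + C d * (X 0 ^ 1 * X 1 ^ 0) + C e * (X 0 ^ 0 * X 1 ^ 1) +
        C f * (X 0 ^ 0 * X 1 ^ 0) := by ring
    simp only [rw_eq, coeff_add, aux, coeff_zero] at key
    exact ⟨by simpa using key 2 0, by simpa using key 1 1, by simpa using key 0 2,
      by simpa using key 1 0, by simpa using key 0 1, by simpa using key 0 0⟩
  · rintro ⟨rfl, rfl, rfl, rfl, rfl, rfl⟩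
    simp

theorem linear_eq_zero_iff (d e f : R) :
    (C d * X 0 + C e * X 1 + C f : MvPolynomial (Fin 2) R) = 0 ↔ d = 0 ∧ e = 0 ∧ f = 0 := by
  simpa using quadratic_eq_zero_iff 0 0 0 d e f

variable {br : R → R → R} {B : MvPolynomial (Fin 2) R → MvPolynomial (Fin 2) R →
  MvPolynomial (Fin 2) R}

theorem leibniz_iff_coefficients (leibniz : ∀ f g h, B f (g * h) = B f g * h + g * B f h)
    {y : MvPolynomial (Fin 2) R} {β γ ν : R → R}
    (hy : ∀ a, B y (C a) = C (β a) * X 0 + C (γ a) * X 1 + C (ν a)) (a b : R) :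
    β (a * b) = a * β b + b * β a ∧ γ (a * b) = a * γ b + b * γ a ∧
      ν (a * b) = a * ν b + b * ν a := by
  have h := leibniz y (C a) (C b)
  rw [← C_mul, hy, hy, hy] at h
  have key := (linear_eq_zero_iff (β (a * b) - (a * β b + b * β a))
    (γ (a * b) - (a * γ b + b * γ a)) (ν (a * b) - (a * ν b + b * ν a))).1 (by
      simp only [C_sub, C_add, C_mul]
      linear_combination h)
  simpa only [sub_eq_zero] using key

theorem jacobiator_C_C (hbr : ∀ a b, br a b = -br b a)
    (add_right : ∀ f g h, B f (g + h) = B f g + B f h) (anti : ∀ f g, B f g = -B g f)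
    (leibniz : ∀ f g h, B f (g * h) = B f g * h + g * B f h)
    (hCC : ∀ a b, B (C a) (C b) = C (br a b)) {α11 α12 ν1 α21 α22 ν2 : R → R}
    (h0 : ∀ a, B (X 0) (C a) = C (α11 a) * X 0 + C (α12 a) * X 1 + C (ν1 a))
    (h1 : ∀ a, B (X 1) (C a) = C (α21 a) * X 0 + C (α22 a) * X 1 + C (ν2 a))
    {y : MvPolynomial (Fin 2) R} {β γ ν : R → R}
    (hy : ∀ a, B y (C a) = C (β a) * X 0 + C (γ a) * X 1 + C (ν a)) (a b : R) :
    B y (B (C a) (C b)) + B (C a) (B (C b) y) + B (C b) (B y (C a)) =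
      C (β (br a b) - br (β a) b - br a (β b) -
          (β a * α11 b - β b * α11 a + γ a * α21 b - γ b * α21 a)) * X 0 +
        C (γ (br a b) - br (γ a) b - br a (γ b) -
          (β a * α12 b - β b * α12 a + γ a * α22 b - γ b * α22 a)) * X 1 +
        C (ν (br a b) - br (ν a) b - br a (ν b) -
          (β a * ν1 b - β b * ν1 a + γ a * ν2 b - γ b * ν2 a)) := by
  have neg_right (f g) : B f (-g) = -B f g := by
    have h0 : B f 0 = 0 := by simpa using add_right f 0 0
    have := add_right f g (-g)
    rw [add_neg_cancel, h0] at this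
    linear_combination -this
  have hc0 (a) := (anti (C a) (X 0)).trans (congrArg Neg.neg (h0 a))
  have hc1 (a) := (anti (C a) (X 1)).trans (congrArg Neg.neg (h1 a))
  rw [anti (C b) y, neg_right, hy, hy, hCC, hy]
  simp only [add_right, leibniz, hCC, hc0, hc1, hbr b (β a), hbr b (γ a), hbr b (ν a)]
  simp only [C_sub, C_add, C_mul, C_neg]
  ring

theorem jacobiator_C (add_right : ∀ f g h, B f (g + h) = B f g + B f h)
    (smul_right : ∀ (r : k) f g, B f (r • g) = r • B f g) (anti : ∀ f g, B f g = -B g f)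
    (leibniz : ∀ f g h, B f (g * h) = B f g * h + g * B f h)
    (hbr : ∀ a b, br a b = -br b a)
    (hCC : ∀ a b, B (C a) (C b) = C (br a b)) {α11 α12 ν1 α21 α22 ν2 : R → R}
    (h00 : B (X 0) (X 0) = 0) (h11 : B (X 1) (X 1) = 0)
    (h0 : ∀ a, B (X 0) (C a) = C (α11 a) * X 0 + C (α12 a) * X 1 + C (ν1 a))
    (h1 : ∀ a, B (X 1) (C a) = C (α21 a) * X 0 + C (α22 a) * X 1 + C (ν2 a))
    {q11 q12 : k} {w0 w1 w2 : R}
    (h10 : B (X 1) (X 0) =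
      q11 • X 0 ^ 2 + q12 • (X 0 * X 1) + C w1 * X 0 + C w2 * X 1 + C w0) (a : R) :
    B (X 1) (B (X 0) (C a)) + B (X 0) (B (C a) (X 1)) + B (C a) (B (X 1) (X 0)) =
      C (α21 (α11 a) - α11 (α21 a) - (q11 • α11 a + q12 • α21 a - q11 • α22 a)) * X 0 ^ 2 +
      C (α22 (α11 a) - α11 (α22 a) + (α21 (α12 a) - α12 (α21 a)) -
        (2 * q11) • α12 a) * (X 0 * X 1) +
      C (α22 (α12 a) - α12 (α22 a) - q12 • α12 a) * X 1 ^ 2 +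
      C (ν2 (α11 a) - α11 (ν2 a) + (α21 (ν1 a) - ν1 (α21 a)) -
        ((2 * q11) • ν1 a + q12 • ν2 a + w2 * α21 a - w1 * α22 a + br w1 a)) * X 0 +
      C (ν2 (α12 a) - α12 (ν2 a) + (α22 (ν1 a) - ν1 (α22 a)) -
        (q12 • ν1 a + w1 * α12 a - w2 * α11 a + br w2 a)) * X 1 +
      C (ν2 (ν1 a) - ν1 (ν2 a) -
        (w1 * ν1 a + w2 * ν2 a - w0 * α11 a - w0 * α22 a + br w0 a)) := by
  have neg_right (f g) : B f (-g) = -B f g := by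
    have h0 : B f 0 = 0 := by simpa using add_right f 0 0
    have := add_right f g (-g)
    rw [add_neg_cancel, h0] at this
    linear_combination -this
  have hc0 (a) := (anti (C a) (X 0)).trans (congrArg Neg.neg (h0 a))
  have hc1 (a) := (anti (C a) (X 1)).trans (congrArg Neg.neg (h1 a))
  have h01 := (anti (X 0) (X 1)).trans (congrArg Neg.neg h10)
  rw [anti (C a) (X 1), neg_right, h0, h1, h10]
  simp only [add_right, smul_right, pow_two, leibniz, hCC, hc0, hc1, h0, h1, h00, h11, h10, h01,
    hbr a w0, hbr a w1, hbr a w2]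
  simp only [Algebra.smul_def, MvPolynomial.algebraMap_apply, C_sub, C_add, C_neg, map_mul,
    map_ofNat]
  ring

theorem jacobi_of_two_variables
    (D : Derivation k (MvPolynomial (Fin 2) R)
      (Derivation k (MvPolynomial (Fin 2) R) (MvPolynomial (Fin 2) R)))
    (anti : ∀ f g, D f g = -D g f) (h00 : D (X 0) (X 0) = 0) (h11 : D (X 1) (X 1) = 0)
    (jCCC : ∀ a b c, D (C a) (D (C b) (C c)) + D (C b) (D (C c) (C a)) +
      D (C c) (D (C a) (C b)) = 0)
    (jXCC : ∀ i a b, D (X i) (D (C a) (C b)) + D (C a) (D (C b) (X i)) +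
      D (C b) (D (X i) (C a)) = 0)
    (jXXC : ∀ a, D (X 1) (D (X 0) (C a)) + D (X 0) (D (C a) (X 1)) +
      D (C a) (D (X 1) (X 0)) = 0)
    (f g h : MvPolynomial (Fin 2) R) : D f (D g h) + D g (D h f) + D h (D f g) = 0 := by
  have rotate {f g h} (H : D f (D g h) + D g (D h f) + D h (D f g) = 0) :
      D g (D h f) + D h (D f g) + D f (D g h) = 0 := by linear_combination H
  have self_self {f} (hf : D f f = 0) (h) : D f (D f h) + D f (D h f) + D h (D f f) = 0 := by
    rw [hf, anti h f, map_neg, map_zero]; ring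
  have hX (i) : D (X i) (X i) = 0 := by fin_cases i <;> assumption
  have jXXC' (i j a) : D (X i) (D (X j) (C a)) + D (X j) (D (C a) (X i)) +
      D (C a) (D (X i) (X j)) = 0 := by
    by_cases hij : i = j
    · subst hij
      exact self_self (hX i) _
    · obtain ⟨rfl, rfl⟩ | ⟨rfl, rfl⟩ : (i = 1 ∧ j = 0) ∨ (i = 0 ∧ j = 1) := by omega
      · exact jXXC a
      · have := jXXC a
        rw [anti (C a), anti (X 1) (X 0), map_neg, map_neg] at this
        rw [anti (C a), map_neg]
        linear_combination -this
  have jXXX (i j l) : D (X i) (D (X j) (X l)) + D (X j) (D (X l) (X i)) +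
      D (X l) (D (X i) (X j)) = 0 := by
    obtain rfl | rfl | rfl : i = j ∨ j = l ∨ l = i := by omega
    · exact self_self (hX i) _
    · exact rotate (rotate (self_self (hX j) _))
    · exact rotate (self_self (hX l) _)
  refine jacobi_of_generators D anti (Set.range C ∪ Set.range X) (by simp) (by simp) ?_ f g h
  rintro _ (⟨a, rfl⟩ | ⟨i, rfl⟩) _ (⟨b, rfl⟩ | ⟨j, rfl⟩) _ (⟨c, rfl⟩ | ⟨l, rfl⟩)
  · exact jCCC a b c
  · exact rotate (jXCC l a b)
  · exact rotate (rotate (jXCC j c a))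
  · exact rotate (rotate (jXXC' j l a))
  · exact jXCC i b c
  · exact rotate (jXXC' l i b)
  · exact jXXC' i j c
  · exact jXXX i j l

end TwoVariables

end DoublePoissonExtension

open DoublePoissonExtension

theorem stmt_6
    (k : Type*) [Field k] [CharZero k]
    (R : Type*) [CommRing R] [Algebra k R]
    (br : R → R → R) (hbr : IsPoissonBr k R br)
    (q11 q12 : k) (w0 w1 w2 : R)
    (α11 α12 α21 α22 ν1 ν2 : R →ₗ[k] R) :
    (∃ B : MvPolynomial (Fin 2) R → MvPolynomial (Fin 2) R → MvPolynomial (Fin 2) R,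
      IsPoissonBr k (MvPolynomial (Fin 2) R) B ∧
      (∀ a b : R, B (C a) (C b) = C (br a b)) ∧
      (B (X 1) (X 0) =
        q11 • X 0 ^ 2 + q12 • (X 0 * X 1) + C w1 * X 0 + C w2 * X 1 + C w0) ∧
      (∀ a : R, B (X 0) (C a) = C (α11 a) * X 0 + C (α12 a) * X 1 + C (ν1 a)) ∧
      (∀ a : R, B (X 1) (C a) = C (α21 a) * X 0 + C (α22 a) * X 1 + C (ν2 a))) ↔
    ((∀ a b : R, α11 (a * b) = a * α11 b + b * α11 a) ∧
    (∀ a b : R, α12 (a * b) = a * α12 b + b * α12 a) ∧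
    (∀ a b : R, α21 (a * b) = a * α21 b + b * α21 a) ∧
    (∀ a b : R, α22 (a * b) = a * α22 b + b * α22 a) ∧
    (∀ a b : R, ν1 (a * b) = a * ν1 b + b * ν1 a) ∧
    (∀ a b : R, ν2 (a * b) = a * ν2 b + b * ν2 a) ∧
    (∀ a b : R, α11 (br a b) - br (α11 a) b - br a (α11 b) =
      α12 a * α21 b - α21 a * α12 b) ∧
    (∀ a b : R, α22 (br a b) - br (α22 a) b - br a (α22 b) =
      α21 a * α12 b - α12 a * α21 b) ∧
    (∀ a b : R, α12 (br a b) - br (α12 a) b - br a (α12 b) =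
      α11 a * α12 b - α12 a * α11 b + α12 a * α22 b - α22 a * α12 b) ∧
    (∀ a b : R, α21 (br a b) - br (α21 a) b - br a (α21 b) =
      α21 a * α11 b - α11 a * α21 b + α22 a * α21 b - α21 a * α22 b) ∧
    (∀ a b : R, ν1 (br a b) - br (ν1 a) b - br a (ν1 b) =
      α11 a * ν1 b - ν1 a * α11 b + α12 a * ν2 b - ν2 a * α12 b) ∧
    (∀ a b : R, ν2 (br a b) - br (ν2 a) b - br a (ν2 b) =
      α21 a * ν1 b - ν1 a * α21 b + α22 a * ν2 b - ν2 a * α22 b) ∧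
    (∀ a : R, α21 (α11 a) - α11 (α21 a) = q11 • α11 a + q12 • α21 a - q11 • α22 a) ∧
    (∀ a : R, α22 (α11 a) - α11 (α22 a) + (α21 (α12 a) - α12 (α21 a)) = (2 * q11) • α12 a) ∧
    (∀ a : R, α22 (α12 a) - α12 (α22 a) = q12 • α12 a) ∧
    (∀ a : R, ν2 (α11 a) - α11 (ν2 a) + (α21 (ν1 a) - ν1 (α21 a)) =
      (2 * q11) • ν1 a + q12 • ν2 a + w2 * α21 a - w1 * α22 a + br w1 a) ∧
    (∀ a : R, ν2 (α12 a) - α12 (ν2 a) + (α22 (ν1 a) - ν1 (α22 a)) =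
      q12 • ν1 a + w1 * α12 a - w2 * α11 a + br w2 a) ∧
    (∀ a : R, ν2 (ν1 a) - ν1 (ν2 a) =
      w1 * ν1 a + w2 * ν2 a - w0 * α11 a - w0 * α22 a + br w0 a)) := by
  constructor
  · rintro ⟨B, ⟨-, add_right, -, smul_right, anti, jacobi, leibniz⟩, hCC, h10, h0, h1⟩
    have self_zero (f : MvPolynomial (Fin 2) R) : B f f = 0 := by
      have h2 : (2 : k) • B f f = 0 := by
        rw [two_smul]; nth_rewrite 1 [anti]; exact neg_add_cancel _
      exact (smul_eq_zero_iff_right two_ne_zero).1 h2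
    have d0 := leibniz_iff_coefficients leibniz h0
    have d1 := leibniz_iff_coefficients leibniz h1
    have j0 (a b : R) := (linear_eq_zero_iff _ _ _).1
      ((jacobiator_C_C hbr.2.2.2.2.1 add_right anti leibniz hCC h0 h1 h0 a b).symm.trans
        (jacobi _ _ _))
    have j1 (a b : R) := (linear_eq_zero_iff _ _ _).1
      ((jacobiator_C_C hbr.2.2.2.2.1 add_right anti leibniz hCC h0 h1 h1 a b).symm.trans
        (jacobi _ _ _))
    have j10 (a : R) := (quadratic_eq_zero_iff _ _ _ _ _ _).1
      ((jacobiator_C add_right smul_right anti leibniz hbr.2.2.2.2.1 hCC (self_zero _)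
        (self_zero _) h0 h1 h10 a).symm.trans (jacobi _ _ _))
    refine ⟨fun a b => (d0 a b).1, fun a b => (d0 a b).2.1, fun a b => (d1 a b).1,
      fun a b => (d1 a b).2.1, fun a b => (d0 a b).2.2, fun a b => (d1 a b).2.2,
      fun a b => ?_, fun a b => ?_, fun a b => ?_, fun a b => ?_, fun a b => ?_, fun a b => ?_,
      fun a => sub_eq_zero.1 (j10 a).1, fun a => sub_eq_zero.1 (j10 a).2.1,
      fun a => sub_eq_zero.1 (j10 a).2.2.1, fun a => sub_eq_zero.1 (j10 a).2.2.2.1,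
      fun a => sub_eq_zero.1 (j10 a).2.2.2.2.1, fun a => sub_eq_zero.1 (j10 a).2.2.2.2.2⟩
    · linear_combination (j0 a b).1
    · linear_combination (j1 a b).2.1
    · linear_combination (j0 a b).2.1
    · linear_combination (j1 a b).1
    · linear_combination (j0 a b).2.2
    · linear_combination (j1 a b).2.2
  · rintro ⟨d11, d12, d21, d22, dν1, dν2, j11, j22, j12, j21, jν1, jν2, c00, c01, c11, c0, c1, c⟩
    let ℓ (β γ ν : R →ₗ[k] R) (hβ : ∀ a b, β (a * b) = a * β b + b * β a)
        (hγ : ∀ a b, γ (a * b) = a * γ b + b * γ a) (hν : ∀ a b, ν (a * b) = a * ν b + b * ν a) :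
        Derivation k R (MvPolynomial (Fin 2) R) := Derivation.mk'
      { toFun a := C (β a) * X 0 + C (γ a) * X 1 + C (ν a)
        map_add' a b := by simp only [map_add]; ring
        map_smul' r a := by
          simp only [map_smul, C_smul, RingHom.id_apply, smul_add, smul_mul_assoc] }
      (fun a b => by
        simp only [LinearMap.coe_mk, AddHom.coe_mk, hβ, hγ, hν, C_add, C_mul, smul_eq_C_mul]
        ring)
    let p : MvPolynomial (Fin 2) R :=
      q11 • X 0 ^ 2 + q12 • (X 0 * X 1) + C w1 * X 0 + C w2 * X 1 + C w0
    obtain ⟨D, anti, hCC, hXC, hXX⟩ := exists_biderivation (σ := Fin 2) hbr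
      ![ℓ α11 α12 ν1 d11 d12 dν1, ℓ α21 α22 ν2 d21 d22 dν2] !![0, -p; p, 0]
      (by simp [Fin.forall_fin_two])
    have h0 (a : R) : D (X 0) (C a) = C (α11 a) * X 0 + C (α12 a) * X 1 + C (ν1 a) := hXC 0 a
    have h1 (a : R) : D (X 1) (C a) = C (α21 a) * X 0 + C (α22 a) * X 1 + C (ν2 a) := hXC 1 a
    have h10 : D (X 1) (X 0) = p := hXX 1 0
    have h00 : D (X 0) (X 0) = 0 := hXX 0 0
    have h11 : D (X 1) (X 1) = 0 := hXX 1 1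
    have add_right (f g h : MvPolynomial (Fin 2) R) : D f (g + h) = D f g + D f h := map_add _ _ _
    have smul_right (r : k) (f g : MvPolynomial (Fin 2) R) : D f (r • g) = r • D f g :=
      Derivation.map_smul _ _ _
    have leibniz (f g h : MvPolynomial (Fin 2) R) : D f (g * h) = D f g * h + g * D f h := by
      rw [Derivation.leibniz, smul_eq_mul, smul_eq_mul]; ring
    have j0 (a b : R) := (jacobiator_C_C (B := fun f g => D f g) hbr.2.2.2.2.1 add_right anti
      leibniz hCC h0 h1 h0 a b).trans ((linear_eq_zero_iff _ _ _).2
        ⟨by linear_combination j11 a b, by linear_combination j12 a b,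
          by linear_combination jν1 a b⟩)
    have j1 (a b : R) := (jacobiator_C_C (B := fun f g => D f g) hbr.2.2.2.2.1 add_right anti
      leibniz hCC h0 h1 h1 a b).trans ((linear_eq_zero_iff _ _ _).2
        ⟨by linear_combination j21 a b, by linear_combination j22 a b,
          by linear_combination jν2 a b⟩)
    have j10 (a : R) := (jacobiator_C (B := fun f g => D f g) add_right smul_right anti leibniz
      hbr.2.2.2.2.1 hCC h00 h11 h0 h1 h10 a).trans ((quadratic_eq_zero_iff _ _ _ _ _ _).2
        ⟨sub_eq_zero.2 (c00 a), sub_eq_zero.2 (c01 a), sub_eq_zero.2 (c11 a),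
          sub_eq_zero.2 (c0 a), sub_eq_zero.2 (c1 a), sub_eq_zero.2 (c a)⟩)
    refine ⟨fun f g => D f g, ⟨fun f g h => by simp, add_right, fun r f g => by simp, smul_right,
      anti, ?_, leibniz⟩, hCC, h10, h0, h1⟩
    refine jacobi_of_two_variables D anti h00 h11 (fun a b c => ?_) (fun i => ?_) j10
    · rw [hCC, hCC, hCC, hCC, hCC, hCC, ← C_add, ← C_add, hbr.2.2.2.2.2.1, C_0]
    · fin_cases i
      exacts [j0, j1]
end

section
/- Let A be a commutative ring and let B : A × A → A be a biadditive map that is antisymmetric and is a derivation in each argument (i.e. B(f, gh) = B(f,g)h + gB(f,h) for all f,g,h ∈ A). Define the Jacobiator J(f,g,h) = B(B(f,g),h) + B(B(g,h),f) + B(B(h,f),g). If J(f,g,h₁) = 0 and J(f,g,h₂) = 0, then J(f,g,h₁h₂) = 0. -/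
theorem stmt_7 (A : Type*) [CommRing A] (B : A → A → A)
    (haddl : ∀ f g h : A, B (f + g) h = B f h + B g h)
    (haddr : ∀ f g h : A, B f (g + h) = B f g + B f h)
    (hanti : ∀ f g : A, B f g = - B g f)
    (hleib : ∀ f g h : A, B f (g * h) = B f g * h + g * B f h)
    (f g h₁ h₂ : A)
    (H1 : B (B f g) h₁ + B (B g h₁) f + B (B h₁ f) g = 0)
    (H2 : B (B f g) h₂ + B (B g h₂) f + B (B h₂ f) g = 0) :
    B (B f g) (h₁ * h₂) + B (B g (h₁ * h₂)) f + B (B (h₁ * h₂) f) g = 0 := by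
  have hleibl : ∀ f g h : A, B (f * g) h = B f h * g + f * B g h := fun f g h => by
    rw [hanti, hleib, hanti f h, hanti g h]; ring
  rw [hleib (B f g), hleib g, hleibl h₁ h₂ f, haddl, haddl, hleibl, hleibl, hleibl, hleibl,
    hanti h₂ g, hanti h₁ g]
  linear_combination h₂ * H1 + h₁ * H2
end

section
/- Let R be a Poisson algebra over k and let A = R[y₁,y₂] be a double Poisson extension of R with DE-data {q = {q₁₁,q₁₂}, α = (α_ij), ν = (ν₁,ν₂), w = {w₁,w₂,w₀}}, and suppose α₁₂ = 0. Then: (i) the subring R[y₁] of A is a Poisson subalgebra, and its bracket satisfies {y₁,a} = α₁₁(a)y₁ + ν₁(a) for a ∈ R; (ii) there exist derivations β and μ of R[y₁] with β(a) = α₂₂(a), μ(a) = α₂₁(a)y₁ + ν₂(a) for all a ∈ R, β(y₁) = q₁₂y₁ + w₂, μ(y₁) = q₁₁y₁² + w₁y₁ + w₀, such that {y₂, f} = β(f)y₂ + μ(f) for all f ∈ R[y₁]. Hence A = R[y₁; α₁₁, ν₁]_p[y₂; β, μ]_p is an iterated Poisson polynomial extension. -/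
open MvPolynomial

/-- The subalgebra `R[y₁]` of `R[y₁,y₂]`. -/
noncomputable def Ry1 (R : Type*) [CommRing R] : Subalgebra R (MvPolynomial (Fin 2) R) :=
  Algebra.adjoin R {X 0}

section Ry1

variable {k R : Type*} [Field k] [CommRing R] [Algebra k R]

theorem X_zero_mem_Ry1 : (X 0 : MvPolynomial (Fin 2) R) ∈ Ry1 R :=
  Algebra.subset_adjoin rfl

theorem C_mem_Ry1 (a : R) : (C a : MvPolynomial (Fin 2) R) ∈ Ry1 R :=
  (Ry1 R).algebraMap_mem a

theorem smul_mem_Ry1 (c : k) {f : MvPolynomial (Fin 2) R} (hf : f ∈ Ry1 R) : c • f ∈ Ry1 R := by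
  rw [algebra_compatible_smul R c f]
  exact (Ry1 R).smul_mem hf _

/-- Induction principle for `R[y₁]`. -/
theorem Ry1_induction {p : MvPolynomial (Fin 2) R → Prop} (hC : ∀ a, p (C a)) (hX : p (X 0))
    (hadd : ∀ f g, f ∈ Ry1 R → g ∈ Ry1 R → p f → p g → p (f + g))
    (hmul : ∀ f g, f ∈ Ry1 R → g ∈ Ry1 R → p f → p g → p (f * g))
    {f : MvPolynomial (Fin 2) R} (hf : f ∈ Ry1 R) : p f := by
  refine Algebra.adjoin_induction (p := fun f _ => p f) ?_ hC hadd hmul hf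
  rintro _ rfl
  exact hX

/-- The evaluation `y₂ ↦ 0` on `R[y₁,y₂]`. -/
noncomputable def evalY2Zero (R : Type*) [CommRing R] :
    MvPolynomial (Fin 2) R →ₐ[R] MvPolynomial (Fin 2) R :=
  aeval ![X 0, 0]

theorem evalY2Zero_X_zero : evalY2Zero R (X 0) = X 0 := by simp [evalY2Zero]

theorem evalY2Zero_X_one : evalY2Zero R (X 1) = 0 := by simp [evalY2Zero]

theorem evalY2Zero_C (a : R) : evalY2Zero R (C a) = C a := (evalY2Zero R).commutes a

theorem evalY2Zero_smul (c : k) (f : MvPolynomial (Fin 2) R) :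
    evalY2Zero R (c • f) = c • evalY2Zero R f := by
  rw [algebra_compatible_smul R c f, map_smul, ← algebra_compatible_smul]

theorem evalY2Zero_mem (f : MvPolynomial (Fin 2) R) : evalY2Zero R f ∈ Ry1 R := by
  induction f using MvPolynomial.induction_on with
  | C a => rw [evalY2Zero_C]; exact C_mem_Ry1 a
  | add f g hf hg => rw [map_add]; exact add_mem hf hg
  | mul_X f i hf =>
    rw [map_mul]
    refine mul_mem hf ?_
    fin_cases i
    · exact evalY2Zero_X_zero.symm.subst (motive := (· ∈ Ry1 R)) X_zero_mem_Ry1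
    · exact evalY2Zero_X_one.symm.subst (motive := (· ∈ Ry1 R)) (zero_mem _)

theorem evalY2Zero_of_mem {f : MvPolynomial (Fin 2) R} (hf : f ∈ Ry1 R) : evalY2Zero R f = f :=
  Ry1_induction (p := fun f => evalY2Zero R f = f) evalY2Zero_C evalY2Zero_X_zero
    (fun f g _ _ hf hg => by rw [map_add, hf, hg]) (fun f g _ _ hf hg => by rw [map_mul, hf, hg]) hf

theorem pderiv_one_smul (c : k) (f : MvPolynomial (Fin 2) R) :
    pderiv 1 (c • f) = c • pderiv 1 f := by
  rw [algebra_compatible_smul R c f, Derivation.map_smul, ← algebra_compatible_smul]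

theorem pderiv_one_of_mem {f : MvPolynomial (Fin 2) R} (hf : f ∈ Ry1 R) : pderiv 1 f = 0 :=
  Ry1_induction (p := fun f => pderiv 1 f = 0) (fun _ => pderiv_C)
    (pderiv_X_of_ne (by decide))
    (fun f g _ _ hf hg => by rw [map_add, hf, hg, add_zero])
    (fun f g _ _ hf hg => by rw [pderiv_mul, hf, hg, zero_mul, mul_zero, add_zero]) hf

/-- The coefficient of `y₂⁰` of `b y₂ + m` with `m ∈ R[y₁]`. -/
theorem evalY2Zero_mul_X_add {b m : MvPolynomial (Fin 2) R} (hm : m ∈ Ry1 R) :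
    evalY2Zero R (b * X 1 + m) = m := by
  rw [map_add, map_mul, evalY2Zero_X_one, evalY2Zero_of_mem hm, mul_zero, zero_add]

/-- The coefficient of `y₂` of `b y₂ + m` with `b, m ∈ R[y₁]`. -/
theorem evalY2Zero_pderiv_mul_X_add {b m : MvPolynomial (Fin 2) R} (hb : b ∈ Ry1 R)
    (hm : m ∈ Ry1 R) : evalY2Zero R (pderiv 1 (b * X 1 + m)) = b := by
  rw [map_add, pderiv_mul, pderiv_X_self, pderiv_one_of_mem hb, pderiv_one_of_mem hm, zero_mul,
    zero_add, add_zero, mul_one, evalY2Zero_of_mem hb]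

/-- An additive map satisfying the Leibniz rule maps `R[y₁]` to itself as soon as it does so
on generators. -/
theorem map_mem_Ry1_of_leibniz {D : MvPolynomial (Fin 2) R → MvPolynomial (Fin 2) R}
    (hadd : ∀ f g, D (f + g) = D f + D g) (hmul : ∀ f g, D (f * g) = D f * g + f * D g)
    (hC : ∀ a, D (C a) ∈ Ry1 R) (hX : D (X 0) ∈ Ry1 R)
    {f : MvPolynomial (Fin 2) R} (hf : f ∈ Ry1 R) : D f ∈ Ry1 R :=
  Ry1_induction (p := fun f => D f ∈ Ry1 R) hC hX
    (fun f g _ _ hf hg => by rw [hadd]; exact add_mem hf hg)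
    (fun f g hf hg hDf hDg => by
      rw [hmul]; exact add_mem (mul_mem hDf hg) (mul_mem hf hDg)) hf

end Ry1

theorem stmt_10
    (k : Type*) [Field k] [CharZero k]
    (R : Type*) [CommRing R] [Algebra k R]
    (br : R → R → R) (hbr : IsPoissonBr k R br)
    (q11 q12 : k) (w0 w1 w2 : R)
    (α11 α12 α21 α22 ν1 ν2 : R →ₗ[k] R)
    (B : MvPolynomial (Fin 2) R → MvPolynomial (Fin 2) R → MvPolynomial (Fin 2) R)
    (hB : IsPoissonBr k (MvPolynomial (Fin 2) R) B)
    (hres : ∀ a b : R, B (C a) (C b) = C (br a b))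
    (hyy : B (X 1) (X 0) =
      q11 • X 0 ^ 2 + q12 • (X 0 * X 1) + C w1 * X 0 + C w2 * X 1 + C w0)
    (hy1 : ∀ a : R, B (X 0) (C a) = C (α11 a) * X 0 + C (α12 a) * X 1 + C (ν1 a))
    (hy2 : ∀ a : R, B (X 1) (C a) = C (α21 a) * X 0 + C (α22 a) * X 1 + C (ν2 a))
    (hα12 : α12 = 0) :
    (∀ f g : MvPolynomial (Fin 2) R, f ∈ Ry1 R → g ∈ Ry1 R → B f g ∈ Ry1 R) ∧
    (∀ a : R, B (X 0) (C a) = C (α11 a) * X 0 + C (ν1 a)) ∧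
    ∃ β μ : MvPolynomial (Fin 2) R → MvPolynomial (Fin 2) R,
      (∀ f : MvPolynomial (Fin 2) R, f ∈ Ry1 R → β f ∈ Ry1 R) ∧
      (∀ f : MvPolynomial (Fin 2) R, f ∈ Ry1 R → μ f ∈ Ry1 R) ∧
      (∀ f g : MvPolynomial (Fin 2) R, f ∈ Ry1 R → g ∈ Ry1 R → β (f + g) = β f + β g) ∧
      (∀ (c : k) (f : MvPolynomial (Fin 2) R), f ∈ Ry1 R → β (c • f) = c • β f) ∧
      (∀ f g : MvPolynomial (Fin 2) R, f ∈ Ry1 R → g ∈ Ry1 R → β (f * g) = f * β g + g * β f) ∧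
      (∀ f g : MvPolynomial (Fin 2) R, f ∈ Ry1 R → g ∈ Ry1 R → μ (f + g) = μ f + μ g) ∧
      (∀ (c : k) (f : MvPolynomial (Fin 2) R), f ∈ Ry1 R → μ (c • f) = c • μ f) ∧
      (∀ f g : MvPolynomial (Fin 2) R, f ∈ Ry1 R → g ∈ Ry1 R → μ (f * g) = f * μ g + g * μ f) ∧
      (∀ a : R, β (C a) = C (α22 a)) ∧
      (∀ a : R, μ (C a) = C (α21 a) * X 0 + C (ν2 a)) ∧
      β (X 0) = q12 • X 0 + C w2 ∧
      μ (X 0) = q11 • X 0 ^ 2 + C w1 * X 0 + C w0 ∧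
      (∀ f : MvPolynomial (Fin 2) R, f ∈ Ry1 R → B (X 1) f = β f * X 1 + μ f) := by
  obtain ⟨-, hadd, -, hsmul, hanti, -, hmul⟩ := hB
  have hXC (a : R) : B (X 0) (C a) = C (α11 a) * X 0 + C (ν1 a) := by simp [hy1, hα12]
  have hXC_mem (a : R) : B (X 0) (C a) ∈ Ry1 R := by
    rw [hXC]
    exact add_mem (mul_mem (C_mem_Ry1 _) X_zero_mem_Ry1) (C_mem_Ry1 _)
  have hXX : B (X 0) (X 0) = 0 := by
    have h2 : (2 : k) • B (X 0) (X 0) = 0 := by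
      rw [two_smul]
      nth_rewrite 1 [hanti]
      exact neg_add_cancel _
    exact (smul_eq_zero_iff_right (two_ne_zero' k)).mp h2
  have hX_mem {g} (hg : g ∈ Ry1 R) : B (X 0) g ∈ Ry1 R :=
    map_mem_Ry1_of_leibniz (hadd _) (hmul _) hXC_mem (hXX ▸ zero_mem _) hg
  have hC_mem (a : R) {g} (hg : g ∈ Ry1 R) : B (C a) g ∈ Ry1 R :=
    map_mem_Ry1_of_leibniz (hadd _) (hmul _) (fun b => hres a b ▸ C_mem_Ry1 _)
      (by rw [hanti]; exact neg_mem (hXC_mem a)) hg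
  have hCβ (a : R) : B (X 1) (C a) = C (α22 a) * X 1 + (C (α21 a) * X 0 + C (ν2 a)) := by
    rw [hy2]; ring
  have hCμ_mem (a : R) : (C (α21 a) * X 0 + C (ν2 a) : MvPolynomial (Fin 2) R) ∈ Ry1 R :=
    add_mem (mul_mem (C_mem_Ry1 _) X_zero_mem_Ry1) (C_mem_Ry1 _)
  have hXβ : B (X 1) (X 0) =
      (q12 • X 0 + C w2) * X 1 + (q11 • X 0 ^ 2 + C w1 * X 0 + C w0) := by
    rw [hyy, ← smul_mul_assoc]; ring
  have hXβ_mem : (q12 • X 0 + C w2 : MvPolynomial (Fin 2) R) ∈ Ry1 R :=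
    add_mem (smul_mem_Ry1 _ X_zero_mem_Ry1) (C_mem_Ry1 _)
  have hXμ_mem : (q11 • X 0 ^ 2 + C w1 * X 0 + C w0 : MvPolynomial (Fin 2) R) ∈ Ry1 R :=
    add_mem (add_mem (smul_mem_Ry1 _ (pow_mem X_zero_mem_Ry1 2))
      (mul_mem (C_mem_Ry1 _) X_zero_mem_Ry1)) (C_mem_Ry1 _)
  have hβmul (f g) (hf : f ∈ Ry1 R) (hg : g ∈ Ry1 R) :
      evalY2Zero R (pderiv 1 (B (X 1) (f * g))) =
        f * evalY2Zero R (pderiv 1 (B (X 1) g)) + g * evalY2Zero R (pderiv 1 (B (X 1) f)) := by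
    simp only [hmul, map_add, pderiv_mul, map_mul, pderiv_one_of_mem hf, pderiv_one_of_mem hg,
      evalY2Zero_of_mem hf, evalY2Zero_of_mem hg, map_zero]
    ring
  have hμmul (f g) (hf : f ∈ Ry1 R) (hg : g ∈ Ry1 R) :
      evalY2Zero R (B (X 1) (f * g)) =
        f * evalY2Zero R (B (X 1) g) + g * evalY2Zero R (B (X 1) f) := by
    rw [hmul, map_add, map_mul, map_mul, evalY2Zero_of_mem hf, evalY2Zero_of_mem hg]
    ring
  refine ⟨fun f g hf hg => ?_, hXC, fun f => evalY2Zero R (pderiv 1 (B (X 1) f)),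
    fun f => evalY2Zero R (B (X 1) f), fun f _ => evalY2Zero_mem _, fun f _ => evalY2Zero_mem _,
    fun f g _ _ => by simp only [hadd, map_add],
    fun c f _ => by simp only [hsmul, pderiv_one_smul, evalY2Zero_smul], hβmul,
    fun f g _ _ => by simp only [hadd, map_add],
    fun c f _ => by simp only [hsmul, evalY2Zero_smul], hμmul,
    fun a => ?_, fun a => ?_, ?_, ?_, fun f hf => ?_⟩
  · rw [hanti]
    refine neg_mem (map_mem_Ry1_of_leibniz (hadd _) (hmul _) (fun a => ?_) ?_ hf)
    · rw [hanti]; exact neg_mem (hC_mem a hg)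
    · rw [hanti]; exact neg_mem (hX_mem hg)
  · simp only [hCβ, evalY2Zero_pderiv_mul_X_add (C_mem_Ry1 _) (hCμ_mem a)]
  · simp only [hCβ, evalY2Zero_mul_X_add (hCμ_mem a)]
  · simp only [hXβ, evalY2Zero_pderiv_mul_X_add hXβ_mem hXμ_mem]
  · simp only [hXβ, evalY2Zero_mul_X_add hXμ_mem]
  · refine Ry1_induction (p := fun f => B (X 1) f =
      evalY2Zero R (pderiv 1 (B (X 1) f)) * X 1 + evalY2Zero R (B (X 1) f))
      (fun a => ?_) ?_ (fun f g _ _ hf hg => ?_) (fun f g hf hg hBf hBg => ?_) hf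
    · simp only [hCβ, evalY2Zero_pderiv_mul_X_add (C_mem_Ry1 _) (hCμ_mem a),
        evalY2Zero_mul_X_add (hCμ_mem a)]
    · simp only [hXβ, evalY2Zero_pderiv_mul_X_add hXβ_mem hXμ_mem, evalY2Zero_mul_X_add hXμ_mem]
    · simp only [hadd, map_add]
      linear_combination hf + hg
    · rw [hβmul f g hf hg, hμmul f g hf hg, hmul]
      linear_combination g * hBf + f * hBg
end

section
/- Let R be a Poisson algebra over k and let A = R[y₁,y₂] be a double Poisson extension of R with DE-data {q = {q₁₁,q₁₂}, α = (α_ij), ν = (ν₁,ν₂), w = {w₁,w₂,w₀}}, and suppose α₂₁ = 0 and q₁₁ = 0. Then: (i) the subring R[y₂] of A is a Poisson subalgebra, with {y₂,a} = α₂₂(a)y₂ + ν₂(a) for a ∈ R; (ii) there exist derivations β and μ of R[y₂] with β(a) = α₁₁(a), μ(a) = α₁₂(a)y₂ + ν₁(a) for all a ∈ R, β(y₂) = −q₁₂y₂ − w₁, μ(y₂) = −w₂y₂ − w₀, such that {y₁, f} = β(f)y₁ + μ(f) for all f ∈ R[y₂]. Hence A = R[y₂; α₂₂, ν₂]_p[y₁;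 β, μ]_p is an iterated Poisson polynomial extension. -/
open MvPolynomial

/-- The subalgebra `R[y₂]` of `R[y₁,y₂]`. -/
noncomputable def Ry2 (R : Type*) [CommRing R] : Subalgebra R (MvPolynomial (Fin 2) R) :=
  Algebra.adjoin R {X 1}

theorem Ry2_induction {R : Type*} [CommRing R] {p : MvPolynomial (Fin 2) R → Prop}
    (hC : ∀ a, p (C a)) (hX : p (X 1)) (hadd : ∀ f g, p f → p g → p (f + g))
    (hmul : ∀ f g, f ∈ Ry2 R → g ∈ Ry2 R → p f → p g → p (f * g))
    {f : MvPolynomial (Fin 2) R} (hf : f ∈ Ry2 R) : p f := by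
  induction hf using Algebra.adjoin_induction with
  | mem x hx => rw [Set.mem_singleton_iff.mp hx]; exact hX
  | algebraMap r => exact hC r
  | add x y _ _ hx hy => exact hadd x y hx hy
  | mul x y hx' hy' hx hy => exact hmul x y hx' hy' hx hy

theorem C_mem_Ry2 {R : Type*} [CommRing R] (a : R) : C a ∈ Ry2 R :=
  (Ry2 R).algebraMap_mem a

theorem X_one_mem_Ry2 (R : Type*) [CommRing R] : X 1 ∈ Ry2 R :=
  Algebra.subset_adjoin rfl

/-- An additive map satisfying the Leibniz rule preserves `R[y₂]` as soon as it sends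
`R` and `y₂` into `R[y₂]`. -/
theorem map_mem_Ry2_of_leibniz {R : Type*} [CommRing R]
    {D : MvPolynomial (Fin 2) R → MvPolynomial (Fin 2) R}
    (hadd : ∀ f g, D (f + g) = D f + D g) (hmul : ∀ f g, D (f * g) = D f * g + f * D g)
    (hC : ∀ a, D (C a) ∈ Ry2 R) (hX : D (X 1) ∈ Ry2 R)
    {f : MvPolynomial (Fin 2) R} (hf : f ∈ Ry2 R) : D f ∈ Ry2 R := by
  refine Ry2_induction (p := fun f => D f ∈ Ry2 R) hC hX ?_ ?_ hf
  · intro f g hf hg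
    rw [hadd]
    exact add_mem hf hg
  · intro f g hf hg hDf hDg
    rw [hmul]
    exact add_mem (mul_mem hDf hg) (mul_mem hf hDg)

/-- The substitution `y₁ ↦ 0`. -/
noncomputable def evalX0 (R : Type*) [CommRing R] :
    MvPolynomial (Fin 2) R →ₐ[R] MvPolynomial (Fin 2) R :=
  aeval ![0, X 1]

theorem evalX0_X_zero (R : Type*) [CommRing R] : evalX0 R (X 0) = 0 := by simp [evalX0]

theorem evalX0_X_one (R : Type*) [CommRing R] : evalX0 R (X 1) = X 1 := by simp [evalX0]

theorem evalX0_C {R : Type*} [CommRing R] (a : R) : evalX0 R (C a) = C a :=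
  (evalX0 R).commutes a

theorem evalX0_mem {R : Type*} [CommRing R] (f : MvPolynomial (Fin 2) R) :
    evalX0 R f ∈ Ry2 R := by
  induction f using MvPolynomial.induction_on with
  | C a => rw [evalX0_C]; exact C_mem_Ry2 a
  | add p q hp hq => rw [map_add]; exact add_mem hp hq
  | mul_X p i hp =>
    rw [map_mul]
    refine mul_mem hp ?_
    fin_cases i
    · simp [evalX0_X_zero]
    · simpa [evalX0_X_one] using X_one_mem_Ry2 R

theorem evalX0_of_mem {R : Type*} [CommRing R] {f : MvPolynomial (Fin 2) R}
    (hf : f ∈ Ry2 R) : evalX0 R f = f :=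
  Ry2_induction (p := fun f => evalX0 R f = f) evalX0_C (evalX0_X_one R)
    (fun f g hf hg => by rw [map_add, hf, hg])
    (fun f g _ _ hf hg => by rw [map_mul, hf, hg]) hf

theorem pderiv_zero_of_mem {R : Type*} [CommRing R] {f : MvPolynomial (Fin 2) R}
    (hf : f ∈ Ry2 R) : pderiv 0 f = 0 :=
  Ry2_induction (p := fun f => pderiv 0 f = 0) (fun _ => pderiv_C)
    (pderiv_X_of_ne (by decide))
    (fun f g hf hg => by rw [map_add, hf, hg, add_zero])
    (fun f g _ _ hf hg => by rw [pderiv_mul, hf, hg]; ring) hf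

theorem evalX0_smul {k R : Type*} [CommRing k] [CommRing R] [Algebra k R] (c : k)
    (f : MvPolynomial (Fin 2) R) : evalX0 R (c • f) = c • evalX0 R f := by
  rw [← algebraMap_smul R c f, map_smul, algebraMap_smul]

theorem pderiv_smul_of_tower {k R : Type*} [CommRing k] [CommRing R] [Algebra k R] (c : k)
    (i : Fin 2) (f : MvPolynomial (Fin 2) R) : pderiv i (c • f) = c • pderiv i f := by
  rw [← algebraMap_smul R c f, (pderiv i).map_smul, algebraMap_smul]

theorem IsPoissonBr.self_eq_zero {k S : Type*} [Field k] [CharZero k] [CommRing S]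
    [Algebra k S] {B : S → S → S} (hB : IsPoissonBr k S B) (a : S) : B a a = 0 := by
  obtain ⟨-, -, -, -, hanti, -⟩ := hB
  have h : (2 : k) • B a a = 0 := by
    rw [two_smul]
    nth_rewrite 1 [hanti a a]
    exact neg_add_cancel _
  exact (smul_eq_zero_iff_right (two_ne_zero (α := k))).mp h

theorem stmt_11
    (k : Type*) [Field k] [CharZero k]
    (R : Type*) [CommRing R] [Algebra k R]
    (br : R → R → R) (hbr : IsPoissonBr k R br)
    (q11 q12 : k) (w0 w1 w2 : R)
    (α11 α12 α21 α22 ν1 ν2 : R →ₗ[k] R)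
    (B : MvPolynomial (Fin 2) R → MvPolynomial (Fin 2) R → MvPolynomial (Fin 2) R)
    (hB : IsPoissonBr k (MvPolynomial (Fin 2) R) B)
    (hres : ∀ a b : R, B (C a) (C b) = C (br a b))
    (hyy : B (X 1) (X 0) =
      q11 • X 0 ^ 2 + q12 • (X 0 * X 1) + C w1 * X 0 + C w2 * X 1 + C w0)
    (hy1 : ∀ a : R, B (X 0) (C a) = C (α11 a) * X 0 + C (α12 a) * X 1 + C (ν1 a))
    (hy2 : ∀ a : R, B (X 1) (C a) = C (α21 a) * X 0 + C (α22 a) * X 1 + C (ν2 a))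
    (hα21 : α21 = 0) (hq11 : q11 = 0) :
    (∀ f g : MvPolynomial (Fin 2) R, f ∈ Ry2 R → g ∈ Ry2 R → B f g ∈ Ry2 R) ∧
    (∀ a : R, B (X 1) (C a) = C (α22 a) * X 1 + C (ν2 a)) ∧
    ∃ β μ : MvPolynomial (Fin 2) R → MvPolynomial (Fin 2) R,
      (∀ f : MvPolynomial (Fin 2) R, f ∈ Ry2 R → β f ∈ Ry2 R) ∧
      (∀ f : MvPolynomial (Fin 2) R, f ∈ Ry2 R → μ f ∈ Ry2 R) ∧
      (∀ f g : MvPolynomial (Fin 2) R, f ∈ Ry2 R → g ∈ Ry2 R → β (f + g) = β f + β g) ∧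
      (∀ (c : k) (f : MvPolynomial (Fin 2) R), f ∈ Ry2 R → β (c • f) = c • β f) ∧
      (∀ f g : MvPolynomial (Fin 2) R, f ∈ Ry2 R → g ∈ Ry2 R → β (f * g) = f * β g + g * β f) ∧
      (∀ f g : MvPolynomial (Fin 2) R, f ∈ Ry2 R → g ∈ Ry2 R → μ (f + g) = μ f + μ g) ∧
      (∀ (c : k) (f : MvPolynomial (Fin 2) R), f ∈ Ry2 R → μ (c • f) = c • μ f) ∧
      (∀ f g : MvPolynomial (Fin 2) R, f ∈ Ry2 R → g ∈ Ry2 R → μ (f * g) = f * μ g + g * μ f) ∧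
      (∀ a : R, β (C a) = C (α11 a)) ∧
      (∀ a : R, μ (C a) = C (α12 a) * X 1 + C (ν1 a)) ∧
      β (X 1) = -(q12 • X 1) - C w1 ∧
      μ (X 1) = -(C w2 * X 1) - C w0 ∧
      (∀ f : MvPolynomial (Fin 2) R, f ∈ Ry2 R → B (X 0) f = β f * X 0 + μ f) := by
  subst hα21 hq11
  have hself := hB.self_eq_zero
  obtain ⟨hadd₁, hadd₂, -, hsmul₂, hanti, -, hmul₂⟩ := hB
  have hmul₁ : ∀ f g h, B (f * g) h = B f h * g + f * B g h := fun f g h => by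
    rw [hanti, hmul₂, hanti h f, hanti h g]; ring
  have hy2' : ∀ a : R, B (X 1) (C a) = C (α22 a) * X 1 + C (ν2 a) := fun a => by
    simp [hy2]
  have hX0X1 : B (X 0) (X 1) =
      (-(q12 • X 1) - C w1) * X 0 + (-(C w2 * X 1) - C w0) := by
    rw [hanti, hyy, zero_smul, mul_comm (X 0) (X 1), ← smul_mul_assoc]
    ring
  have hsubX : ∀ a : R, C (α22 a) * X 1 + C (ν2 a) ∈ Ry2 R := fun a =>
    add_mem (mul_mem (C_mem_Ry2 _) (X_one_mem_Ry2 R)) (C_mem_Ry2 _)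
  have hpart0 : ∀ {b c : MvPolynomial (Fin 2) R}, b ∈ Ry2 R → c ∈ Ry2 R →
      evalX0 R (b * X 0 + c) = c := fun {b c} _ hc => by
    rw [map_add, map_mul, evalX0_X_zero, mul_zero, zero_add, evalX0_of_mem hc]
  have hpart1 : ∀ {b c : MvPolynomial (Fin 2) R}, b ∈ Ry2 R → c ∈ Ry2 R →
      evalX0 R (pderiv 0 (b * X 0 + c)) = b := fun {b c} hb hc => by
    rw [map_add, pderiv_mul, pderiv_zero_of_mem hb, pderiv_zero_of_mem hc, pderiv_X_self,
      zero_mul, zero_add, add_zero, mul_one, evalX0_of_mem hb]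
  have hα : ∀ a : R, C (α12 a) * X 1 + C (ν1 a) ∈ Ry2 R := fun a =>
    add_mem (mul_mem (C_mem_Ry2 _) (X_one_mem_Ry2 R)) (C_mem_Ry2 _)
  have hβX : -(q12 • X 1) - C w1 ∈ Ry2 R := by
    refine sub_mem (neg_mem ?_) (C_mem_Ry2 _)
    rw [← algebraMap_smul R q12 (X 1 : MvPolynomial (Fin 2) R)]
    exact (Ry2 R).smul_mem (X_one_mem_Ry2 R) _
  have hμX : -(C w2 * X 1) - C w0 ∈ Ry2 R :=
    sub_mem (neg_mem (mul_mem (C_mem_Ry2 _) (X_one_mem_Ry2 R))) (C_mem_Ry2 _)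
  have hβmul : ∀ f g : MvPolynomial (Fin 2) R, f ∈ Ry2 R → g ∈ Ry2 R →
      evalX0 R (pderiv 0 (B (X 0) (f * g))) =
        f * evalX0 R (pderiv 0 (B (X 0) g)) + g * evalX0 R (pderiv 0 (B (X 0) f)) :=
    fun f g hf hg => by
      simp only [hmul₂, map_add, pderiv_mul, map_mul, pderiv_zero_of_mem hf,
        pderiv_zero_of_mem hg, evalX0_of_mem hf, evalX0_of_mem hg, map_zero]
      ring
  have hμmul : ∀ f g : MvPolynomial (Fin 2) R, f ∈ Ry2 R → g ∈ Ry2 R →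
      evalX0 R (B (X 0) (f * g)) =
        f * evalX0 R (B (X 0) g) + g * evalX0 R (B (X 0) f) :=
    fun f g hf hg => by
      simp only [hmul₂, map_add, map_mul, evalX0_of_mem hf, evalX0_of_mem hg]
      ring
  refine ⟨fun f g hf hg => ?_, hy2', fun f => evalX0 R (pderiv 0 (B (X 0) f)),
    fun f => evalX0 R (B (X 0) f), fun _ _ => evalX0_mem _, fun _ _ => evalX0_mem _,
    fun f g _ _ => by simp only [hadd₂, map_add],
    fun c f _ => by simp only [hsmul₂, pderiv_smul_of_tower, evalX0_smul], hβmul,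
    fun f g _ _ => by simp only [hadd₂, map_add],
    fun c f _ => by simp only [hsmul₂, evalX0_smul], hμmul, fun a => ?_, fun a => ?_, ?_, ?_,
    fun f hf => ?_⟩
  · refine map_mem_Ry2_of_leibniz (D := fun f => B f g) (fun f f' => hadd₁ f f' g)
      (fun f f' => hmul₁ f f' g) (fun a => ?_) ?_ hf
    · refine map_mem_Ry2_of_leibniz (hadd₂ _) (hmul₂ _) (fun b => ?_) ?_ hg
      · rw [hres]
        exact C_mem_Ry2 _
      · rw [hanti, hy2']
        exact neg_mem (hsubX a)
    · refine map_mem_Ry2_of_leibniz (hadd₂ _) (hmul₂ _) (fun b => ?_) ?_ hg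
      · rw [hy2']
        exact hsubX b
      · rw [hself]
        exact zero_mem _
  · simp only [hy1, add_assoc, hpart1 (C_mem_Ry2 (α11 a)) (hα a)]
  · simp only [hy1, add_assoc, hpart0 (C_mem_Ry2 (α11 a)) (hα a)]
  · simp only [hX0X1, hpart1 hβX hμX]
  · simp only [hX0X1, hpart0 hβX hμX]
  · refine Ry2_induction (p := fun f => B (X 0) f =
      evalX0 R (pderiv 0 (B (X 0) f)) * X 0 + evalX0 R (B (X 0) f))
      (fun a => ?_) ?_ (fun f g hf hg => ?_) (fun f g hf' hg' hf hg => ?_) hf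
    · rw [hy1, add_assoc, hpart1 (C_mem_Ry2 (α11 a)) (hα a),
        hpart0 (C_mem_Ry2 (α11 a)) (hα a)]
    · rw [hX0X1, hpart1 hβX hμX, hpart0 hβX hμX]
    · simp only [hadd₂, map_add]
      linear_combination hf + hg
    · rw [hβmul f g hf' hg', hμmul f g hf' hg', hmul₂]
      linear_combination g * hf + f * hg
end

section
/- Let R be a Poisson algebra over k, let β be a derivation of R satisfying β({a,b}) = {β(a),b} + {a,β(b)} for all a,b ∈ R (a Poisson derivation), and let ν be a derivation of R satisfying ν({a,b}) = {ν(a),b} + {a,ν(b)} + β(a)ν(b) − ν(a)β(b) for all a,b ∈ R. Then for any s ∈ R, the map ν' : R → R defined by ν'(r) = β(r)s + ν(r) + {r,s} is a derivation of R and the pair (β, ν') satisfies the same condition: ν'({a,b}) = {ν'(a),b} + {a,ν'(b)} + β(a)ν'(b) − ν'(a)β(b) for all a,b ∈ R. (Consequently, if R[z; β, ν]_p is a Poisson polynomial extension and z = z' + s with s ∈ R, then R[z; β, ν]_p = R[z'; β, ν']_p.) -/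
theorem stmt_13 (k : Type*) [Field k] [CharZero k]
    (R : Type*) [CommRing R] [Algebra k R]
    (br : R → R → R) (hbr : IsPoissonBr k R br)
    (β ν : R → R)
    (hβadd : ∀ a b : R, β (a + b) = β a + β b)
    (hβsmul : ∀ (c : k) (a : R), β (c • a) = c • β a)
    (hβder : ∀ a b : R, β (a * b) = a * β b + b * β a)
    (hβpois : ∀ a b : R, β (br a b) = br (β a) b + br a (β b))
    (hνadd : ∀ a b : R, ν (a + b) = ν a + ν b)
    (hνsmul : ∀ (c : k) (a : R), ν (c • a) = c • ν a)
    (hνder : ∀ a b : R, ν (a * b) = a * ν b + b * ν a)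
    (hνcond : ∀ a b : R, ν (br a b) = br (ν a) b + br a (ν b) + β a * ν b - ν a * β b)
    (s : R) :
    (∀ a b : R, β (a + b) * s + ν (a + b) + br (a + b) s =
      (β a * s + ν a + br a s) + (β b * s + ν b + br b s)) ∧
    (∀ (c : k) (a : R), β (c • a) * s + ν (c • a) + br (c • a) s =
      c • (β a * s + ν a + br a s)) ∧
    (∀ a b : R, β (a * b) * s + ν (a * b) + br (a * b) s =
      a * (β b * s + ν b + br b s) + b * (β a * s + ν a + br a s)) ∧
    (∀ a b : R, β (br a b) * s + ν (br a b) + br (br a b) s =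
      br (β a * s + ν a + br a s) b + br a (β b * s + ν b + br b s) +
      β a * (β b * s + ν b + br b s) - (β a * s + ν a + br a s) * β b) := by
  obtain ⟨add_left, add_right, smul_left, -, anti, jacobi, leib⟩ := hbr
  have leib_left (a b c : R) : br (a * b) c = br a c * b + a * br b c := by
    rw [anti (a * b), leib, anti a c, anti b c]
    ring
  have neg_right (a b : R) : br a (-b) = -br a b := by
    have h := smul_left (-1 : k) b a
    rw [neg_one_smul, neg_one_smul] at h
    rw [anti, h, anti b a, neg_neg]
  refine ⟨fun a b => ?_, fun c a => ?_, fun a b => ?_, fun a b => ?_⟩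
  · rw [hβadd, hνadd, add_left]
    ring
  · rw [hβsmul, hνsmul, smul_left, smul_add, smul_add, smul_mul_assoc]
  · rw [hβder, hνder, leib_left]
    ring
  · have jac : br (br a b) s = br (br a s) b + br a (br b s) := by
      have h := jacobi a b s
      rw [anti s a, neg_right] at h
      rw [anti (br a b) s, anti (br a s) b]
      linear_combination -h
    rw [hβpois, hνcond, jac]
    simp only [add_left, add_right, leib, leib_left]
    rw [anti s b]
    ring
end

section
/- Let R be a Poisson algebra over k and let A = R[y₁,y₂] be a double Poisson extension of R with DE-data {q = {q₁₁,q₁₂}, α = (α_ij), ν = (ν₁,ν₂), w = {w₁,w₂,w₀}}, and suppose q₁₂ ≠ 0. Set p = q₁₁q₁₂⁻¹, z₁ = y₁ and z₂ = py₁ + y₂. Then z₁, z₂ are polynomial generators of A over R (A = R[z₁,z₂]) and the Poisson bracket satisfies {z₂,z₁} = q₁₂z₁z₂ + (w₁ − pw₂)z₁ + w₂z₂ + w₀, {z₁,a} = (α₁₁ − pα₁₂)(a)z₁ + α₁₂(a)z₂ + ν₁(a), and {z₂,a} = (α₂₁ + p(α₁₁ − α₂₂) − p²α₁₂)(a)z₁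 + (pα₁₂ + α₂₂)(a)z₂ + (ν₂ + pν₁)(a) for all a ∈ R; that is, A is a double Poisson extension of R with variables z₁, z₂ and DE-data having q = {0, q₁₂}. -/
open MvPolynomial

/-- A shear of the two variables generates the polynomial ring. -/
theorem MvPolynomial.adjoin_shear_eq_top {R : Type*} [CommRing R] (c : R) :
    Algebra.adjoin R ({X 0, C c * X 0 + X 1} : Set (MvPolynomial (Fin 2) R)) = ⊤ := by
  rw [← top_le_iff, ← MvPolynomial.adjoin_range_X, Algebra.adjoin_le_iff]
  set S := Algebra.adjoin R ({X 0, C c * X 0 + X 1} : Set (MvPolynomial (Fin 2) R))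
  have h0 : (X 0 : MvPolynomial (Fin 2) R) ∈ S := Algebra.subset_adjoin (by simp)
  have h1 : (C c * X 0 + X 1 : MvPolynomial (Fin 2) R) ∈ S := Algebra.subset_adjoin (by simp)
  have h2 : (X 1 : MvPolynomial (Fin 2) R) ∈ S := by
    simpa using S.sub_mem h1 (S.mul_mem (S.algebraMap_mem c) h0)
  rintro _ ⟨i, rfl⟩
  fin_cases i
  · exact h0
  · exact h2

/-- A shear of the two variables is algebraically independent. -/
theorem MvPolynomial.algebraicIndependent_shear {R : Type*} [CommRing R] (c : R) :
    AlgebraicIndependent R ![(X 0 : MvPolynomial (Fin 2) R), C c * X 0 + X 1] := by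
  have h (f : MvPolynomial (Fin 2) R) :
      aeval ![(X 0 : MvPolynomial (Fin 2) R), X 1 - C c * X 0]
        (aeval ![(X 0 : MvPolynomial (Fin 2) R), C c * X 0 + X 1] f) = f := by
    rw [← AlgHom.comp_apply]
    conv_rhs => rw [← AlgHom.id_apply (R := R) f]
    congr 1
    ext i : 1
    fin_cases i <;> simp [algebraMap_eq]
  rw [algebraicIndependent_iff_injective_aeval]
  exact Function.LeftInverse.injective h

theorem stmt_17
    (k : Type*) [Field k] [CharZero k]
    (R : Type*) [CommRing R] [Algebra k R]
    (br : R → R → R) (hbr : IsPoissonBr k R br)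
    (q11 q12 : k) (w0 w1 w2 : R)
    (α11 α12 α21 α22 ν1 ν2 : R →ₗ[k] R)
    (B : MvPolynomial (Fin 2) R → MvPolynomial (Fin 2) R → MvPolynomial (Fin 2) R)
    (hB : IsPoissonBr k (MvPolynomial (Fin 2) R) B)
    (hres : ∀ a b : R, B (C a) (C b) = C (br a b))
    (hyy : B (X 1) (X 0) =
      q11 • X 0 ^ 2 + q12 • (X 0 * X 1) + C w1 * X 0 + C w2 * X 1 + C w0)
    (hy1 : ∀ a : R, B (X 0) (C a) = C (α11 a) * X 0 + C (α12 a) * X 1 + C (ν1 a))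
    (hy2 : ∀ a : R, B (X 1) (C a) = C (α21 a) * X 0 + C (α22 a) * X 1 + C (ν2 a))
    (hq12 : q12 ≠ 0) (p : k) (hp : p = q11 * q12⁻¹) :
    (Algebra.adjoin R ({X 0, p • X 0 + X 1} : Set (MvPolynomial (Fin 2) R)) = ⊤) ∧
    (AlgebraicIndependent R ![(X 0 : MvPolynomial (Fin 2) R), p • X 0 + X 1]) ∧
    (B (p • X 0 + X 1) (X 0) =
      q12 • (X 0 * (p • X 0 + X 1)) + C (w1 - p • w2) * X 0 +
        C w2 * (p • X 0 + X 1) + C w0) ∧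
    (∀ a : R, B (X 0) (C a) =
      C (α11 a - p • α12 a) * X 0 + C (α12 a) * (p • X 0 + X 1) + C (ν1 a)) ∧
    (∀ a : R, B (p • X 0 + X 1) (C a) =
      C (α21 a + p • (α11 a - α22 a) - (p * p) • α12 a) * X 0 +
        C (p • α12 a + α22 a) * (p • X 0 + X 1) + C (ν2 a + p • ν1 a)) := by
  have hp' : C (algebraMap k R q12) * C (algebraMap k R p) =
      (C (algebraMap k R q11) : MvPolynomial (Fin 2) R) := by
    rw [← C_mul, ← map_mul, hp, mul_comm q12, inv_mul_cancel_right₀ hq12]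
  obtain ⟨hadd, -, hsmul, -⟩ := id hB
  refine ⟨?_, ?_, ?_, fun a => ?_, fun a => ?_⟩
  · rw [Algebra.smul_def, MvPolynomial.algebraMap_apply]
    exact adjoin_shear_eq_top _
  · rw [Algebra.smul_def, MvPolynomial.algebraMap_apply]
    exact algebraicIndependent_shear _
  · rw [hadd, hsmul, hB.self_eq_zero, hyy]
    simp only [Algebra.smul_def, MvPolynomial.algebraMap_apply, C_sub, C_mul, ← hp']
    ring
  · rw [hy1]
    simp only [Algebra.smul_def, MvPolynomial.algebraMap_apply, C_sub, C_mul]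
    ring
  · rw [hadd, hsmul, hy1, hy2]
    simp only [Algebra.smul_def, MvPolynomial.algebraMap_apply, C_sub, C_add, map_mul]
    ring
end

section
/- Let R be a Poisson algebra over k and suppose the polynomial ring A = R[y₁,y₂] carries an antisymmetric k-bilinear bracket that is a derivation in each argument, restricts on R to the bracket of R, and satisfies {y₂,y₁} = q₁₁y₁² + q₁₂y₁y₂ + w₁y₁ + w₂y₂ + w₀, {y₁,a} = α₁₁(a)y₁ + α₁₂(a)y₂ + ν₁(a), {y₂,a} = α₂₁(a)y₁ + α₂₂(a)y₂ + ν₂(a) for all a ∈ R, where q₁₁,q₁₂ ∈ k, w₀,w₁,w₂ ∈ R and the α_ij, ν_i are derivations of R. Then the Jacobi identity {y₂,{y₁,a}} + {y₁,{a,y₂}} + {a,{y₂,y₁}} = 0 holds for all a ∈ R if and only if the six conditions hold (as maps R → R, with [f,g] = f∘g − g∘f, elements of R acting by multiplication, and {w,−} : a ↦ {w,a}): [α₂₁,α₁₁] = q₁₁α₁₁ + q₁₂α₂₁ − q₁₁α₂₂; [α₂₂,α₁₁] + [α₂₁,α₁₂] = 2q₁₁α₁₂; [α₂₂,α₁₂]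 = q₁₂α₁₂; [ν₂,α₁₁] + [α₂₁,ν₁] = 2q₁₁ν₁ + q₁₂ν₂ + w₂α₂₁ − w₁α₂₂ + {w₁,−}; [ν₂,α₁₂] + [α₂₂,ν₁] = q₁₂ν₁ + w₁α₁₂ − w₂α₁₁ + {w₂,−}; [ν₂,ν₁] = w₁ν₁ + w₂ν₂ − w₀α₁₁ − w₀α₂₂ + {w₀,−}. -/
open MvPolynomial

theorem MvPolynomial.quadratic_eq_zero_iff {R : Type*} [CommRing R] (a b c d e f : R) :
    (C a * X 0 ^ 2 + C b * (X 0 * X 1) + C c * X 1 ^ 2 + C d * X 0 + C e * X 1 + C f :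
      MvPolynomial (Fin 2) R) = 0 ↔
    a = 0 ∧ b = 0 ∧ c = 0 ∧ d = 0 ∧ e = 0 ∧ f = 0 := by
  constructor
  · intro h
    have key : ∀ i j : ℕ,
        coeff (Finsupp.single 0 i + Finsupp.single 1 j)
          (monomial (Finsupp.single 0 2 + Finsupp.single 1 0) a +
            monomial (Finsupp.single 0 1 + Finsupp.single 1 1) b +
            monomial (Finsupp.single 0 0 + Finsupp.single 1 2) c +
            monomial (Finsupp.single 0 1 + Finsupp.single 1 0) d +
            monomial (Finsupp.single 0 0 + Finsupp.single 1 1) e +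
            monomial (Finsupp.single 0 0 + Finsupp.single 1 0) f :
            MvPolynomial (Fin 2) R) = 0 := by
      intro i j
      rw [← coeff_zero (R := R) (Finsupp.single (0 : Fin 2) i + Finsupp.single 1 j), ← h]
      congr 1
      simp [monomial_eq, Finsupp.prod_add_index', pow_add]
    have inj : ∀ i j i' j' : ℕ,
        (Finsupp.single (0 : Fin 2) i + Finsupp.single 1 j =
          Finsupp.single 0 i' + Finsupp.single 1 j') ↔ (i = i' ∧ j = j') := by
      intro i j i' j'
      simp [Finsupp.ext_iff, Fin.forall_fin_two]
    simp only [coeff_add, coeff_monomial, inj] at key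
    exact ⟨by simpa using key 2 0, by simpa using key 1 1, by simpa using key 0 2,
      by simpa using key 1 0, by simpa using key 0 1, by simpa using key 0 0⟩
  · rintro ⟨rfl, rfl, rfl, rfl, rfl, rfl⟩
    simp

theorem stmt_18
    (k : Type*) [Field k] [CharZero k]
    (R : Type*) [CommRing R] [Algebra k R]
    (br : R → R → R) (hbr : IsPoissonBr k R br)
    (q11 q12 : k) (w0 w1 w2 : R)
    (α11 α12 α21 α22 ν1 ν2 : R →ₗ[k] R)
    (hders : (∀ a b : R, α11 (a * b) = a * α11 b + b * α11 a) ∧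
    (∀ a b : R, α12 (a * b) = a * α12 b + b * α12 a) ∧
    (∀ a b : R, α21 (a * b) = a * α21 b + b * α21 a) ∧
    (∀ a b : R, α22 (a * b) = a * α22 b + b * α22 a) ∧
    (∀ a b : R, ν1 (a * b) = a * ν1 b + b * ν1 a) ∧
    (∀ a b : R, ν2 (a * b) = a * ν2 b + b * ν2 a))
    (B : MvPolynomial (Fin 2) R → MvPolynomial (Fin 2) R → MvPolynomial (Fin 2) R)
    (haddl : ∀ f g h : MvPolynomial (Fin 2) R, B (f + g) h = B f h + B g h)
    (haddr : ∀ f g h : MvPolynomial (Fin 2) R, B f (g + h) = B f g + B f h)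
    (hsmull : ∀ (c : k) (f g : MvPolynomial (Fin 2) R), B (c • f) g = c • B f g)
    (hsmulr : ∀ (c : k) (f g : MvPolynomial (Fin 2) R), B f (c • g) = c • B f g)
    (hanti : ∀ f g : MvPolynomial (Fin 2) R, B f g = - B g f)
    (hderl : ∀ f g h : MvPolynomial (Fin 2) R, B (f * g) h = f * B g h + g * B f h)
    (hderr : ∀ f g h : MvPolynomial (Fin 2) R, B f (g * h) = B f g * h + g * B f h)
    (hres : ∀ a b : R, B (C a) (C b) = C (br a b))
    (hyy : B (X 1) (X 0) =
      q11 • X 0 ^ 2 + q12 • (X 0 * X 1) + C w1 * X 0 + C w2 * X 1 + C w0)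
    (hy1 : ∀ a : R, B (X 0) (C a) = C (α11 a) * X 0 + C (α12 a) * X 1 + C (ν1 a))
    (hy2 : ∀ a : R, B (X 1) (C a) = C (α21 a) * X 0 + C (α22 a) * X 1 + C (ν2 a)) :
    (∀ a : R,
      B (X 1) (B (X 0) (C a)) + B (X 0) (B (C a) (X 1)) + B (C a) (B (X 1) (X 0)) = 0) ↔
    ((∀ a : R, α21 (α11 a) - α11 (α21 a) = q11 • α11 a + q12 • α21 a - q11 • α22 a) ∧
    (∀ a : R, α22 (α11 a) - α11 (α22 a) + (α21 (α12 a) - α12 (α21 a)) = (2 * q11) • α12 a) ∧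
    (∀ a : R, α22 (α12 a) - α12 (α22 a) = q12 • α12 a) ∧
    (∀ a : R, ν2 (α11 a) - α11 (ν2 a) + (α21 (ν1 a) - ν1 (α21 a)) =
      (2 * q11) • ν1 a + q12 • ν2 a + w2 * α21 a - w1 * α22 a + br w1 a) ∧
    (∀ a : R, ν2 (α12 a) - α12 (ν2 a) + (α22 (ν1 a) - ν1 (α22 a)) =
      q12 • ν1 a + w1 * α12 a - w2 * α11 a + br w2 a) ∧
    (∀ a : R, ν2 (ν1 a) - ν1 (ν2 a) =
      w1 * ν1 a + w2 * ν2 a - w0 * α11 a - w0 * α22 a + br w0 a)) := by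
  have smul_eq : ∀ (q : k) (f : MvPolynomial (Fin 2) R), q • f = C (algebraMap k R q) * f := by
    intro q f
    rw [Algebra.smul_def, IsScalarTower.algebraMap_apply k R (MvPolynomial (Fin 2) R),
      algebraMap_eq]
  have neg_right : ∀ f g : MvPolynomial (Fin 2) R, B f (-g) = -B f g := by
    intro f g
    have h := hsmulr (-1) f g
    simpa using h
  have self_zero : ∀ i : Fin 2, B (X i) (X i) = 0 := by
    intro i
    have h := hanti (X i) (X i)
    have h2 : (2 : k) • B (X i) (X i) = 0 := by
      rw [two_smul]
      exact eq_neg_iff_add_eq_zero.mp h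
    exact (smul_eq_zero_iff_right two_ne_zero).mp h2
  have jacobi_eq : ∀ a : R,
      B (X 1) (B (X 0) (C a)) + B (X 0) (B (C a) (X 1)) + B (C a) (B (X 1) (X 0)) =
      C (α21 (α11 a) - α11 (α21 a) - (q11 • α11 a + q12 • α21 a - q11 • α22 a)) * X 0 ^ 2 +
      C (α22 (α11 a) - α11 (α22 a) + (α21 (α12 a) - α12 (α21 a)) - (2 * q11) • α12 a) *
        (X 0 * X 1) +
      C (α22 (α12 a) - α12 (α22 a) - q12 • α12 a) * X 1 ^ 2 +
      C (ν2 (α11 a) - α11 (ν2 a) + (α21 (ν1 a) - ν1 (α21 a)) -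
        ((2 * q11) • ν1 a + q12 • ν2 a + w2 * α21 a - w1 * α22 a + br w1 a)) * X 0 +
      C (ν2 (α12 a) - α12 (ν2 a) + (α22 (ν1 a) - ν1 (α22 a)) -
        (q12 • ν1 a + w1 * α12 a - w2 * α11 a + br w2 a)) * X 1 +
      C (ν2 (ν1 a) - ν1 (ν2 a) -
        (w1 * ν1 a + w2 * ν2 a - w0 * α11 a - w0 * α22 a + br w0 a)) := by
    intro a
    rw [hanti (C a) (X 1), neg_right, hanti (C a), hy1, hy2, hyy]
    simp only [haddr, haddl, hsmull, hderl, hderr, pow_two, hy1, hy2, hyy, hres, self_zero,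
      hanti (X 0) (X 1)]
    simp only [smul_eq, Algebra.smul_def, map_add, map_sub, map_mul, map_ofNat]
    ring
  simp only [jacobi_eq, MvPolynomial.quadratic_eq_zero_iff, sub_eq_zero, forall_and]
end
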